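/- arXiv:1603.05271 — 2 statements merged into one kernel-verified Lean document; each statement's English description precedes it below -/
import Mathlib

section
/- Let V_{λμν}(p) be the topological vertex. For every partition λ with parts λ_1 ≥ λ_2 ≥ … ≥ λ_ℓ > 0 (ℓ the number of nonzero parts), one has V_{λ□∅}(p) = V_{λ∅∅}(p) · ( Σ_{i=1}^{ℓ} p^{−λ_i+i−1} + Σ_{m=ℓ}^∞ p^m ) as an identity in the ring of formal Laurent series ℤ((p)); here Σ_{m≥ℓ} p^m is the Laurent expansion of p^ℓ/(1−p), so the second factor is the value of the convergent series Σ_{i=1}^∞ p^{−λ_i+i−1}. -/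
noncomputable section

open scoped Classical

/-- The field ℚ((p)) of formal Laurent series. -/
abbrev K : Type := LaurentSeries ℚ

/-- The variable p ∈ ℚ((p)). -/
def Kp : K := HahnSeries.single 1 1

/-- The number of legs of a 3D partition asymptotic to `(l, m, n)` containing the
cell `c = (i,j,k)`. -/
def legCount (l m n : YoungDiagram) (c : ℕ × ℕ × ℕ) : ℤ :=
  (if (c.2.1, c.2.2) ∈ l then 1 else 0) + (if (c.2.2, c.1) ∈ m then 1 else 0) +
    (if (c.1, c.2.1) ∈ n then 1 else 0)

/-- `π ⊆ ℤ≥0³` is a 3D partition asymptotic to the triple of partitions `(l, m, n)`.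
Partitions are encoded as Young diagrams, with parts λ_j = colLen j, i.e.
(i,j) ∈ λ ↔ i < λ_j. -/
def IsAsymptotic (π : Set (ℕ × ℕ × ℕ)) (l m n : YoungDiagram) : Prop :=
  (∀ i j k : ℕ, ((i + 1, j, k) ∈ π ∨ (i, j + 1, k) ∈ π ∨ (i, j, k + 1) ∈ π) → (i, j, k) ∈ π) ∧
  (∀ j k : ℕ, ∃ N, ∀ i ≥ N, ((i, j, k) ∈ π ↔ (j, k) ∈ l)) ∧
  (∀ k i : ℕ, ∃ N, ∀ j ≥ N, ((i, j, k) ∈ π ↔ (k, i) ∈ m)) ∧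
  (∀ i j : ℕ, ∃ N, ∀ k ≥ N, ((i, j, k) ∈ π ↔ (i, j) ∈ n))

/-- The renormalized volume |π| = Σ_{c ∈ π} (1 − #legs through c); the sum has
finitely many nonzero terms. -/
def rvol (l m n : YoungDiagram) (π : Set (ℕ × ℕ × ℕ)) : ℤ :=
  ∑ᶠ c ∈ π, (1 - legCount l m n c)

/-- The coefficient of p^k in the topological vertex: the number of 3D partitions
asymptotic to `(l, m, n)` with renormalized volume `k` (a finite number). -/
def vertexCoeff (l m n : YoungDiagram) (k : ℤ) : ℚ :=
  Nat.card {π : Set (ℕ × ℕ × ℕ) // IsAsymptotic π l m n ∧ rvol l m n π = k}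

/-- The topological vertex V_{lmn}(p) ∈ ℚ((p)).  (Its coefficient support is
bounded below, hence partially well ordered; the `dite` realizes it as a Hahn
series.) -/
def vertex (l m n : YoungDiagram) : K :=
  if h : (Function.support (vertexCoeff l m n)).IsPWO then ⟨vertexCoeff l m n, h⟩ else 0

/-- The one-box partition □ = (1). -/
def box : YoungDiagram :=
  ⟨{(0, 0)}, by
    intro x y hyx hx
    simp only [Finset.coe_singleton, Set.mem_singleton_iff] at hx ⊢
    subst hx
    exact le_bot_iff.mp hyx⟩

/-! ### Height functions -/

theorem YoungDiagram.notMem_mono {μ : YoungDiagram} {j k j' k' : ℕ} (h : (j, k) ∉ μ)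
    (hj : j ≤ j') (hk : k ≤ k') : (j', k') ∉ μ :=
  fun h' => h (μ.up_left_mem hj hk h')

theorem YoungDiagram.notMem_of_colLen_le {μ : YoungDiagram} {j k : ℕ} (h : μ.colLen k ≤ j) :
    (j, k) ∉ μ := by
  rw [YoungDiagram.mem_iff_lt_colLen]
  omega

/-- Height functions of the 3D partitions asymptotic to `(μ, m, ∅)`, where `m` is the row of `ε`
cells: the height is normalized to be zero on `μ`, is weakly decreasing off `μ`, and tends to `ε`
along the row `k = 0` and to zero along the other rows and along all columns. -/
structure IsHeight (μ : YoungDiagram) (ε : ℕ) (h : ℕ → ℕ → ℕ) : Prop where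
  zero : ∀ j k, (j, k) ∈ μ → h j k = 0
  left : ∀ j k, (j, k) ∉ μ → h (j + 1) k ≤ h j k
  down : ∀ j k, (j, k) ∉ μ → h j (k + 1) ≤ h j k
  row : ∀ k, ∃ N, ∀ j ≥ N, h j k = if k = 0 then ε else 0
  col : ∀ j, ∃ N, ∀ k ≥ N, h j k = 0

/-- The renormalized volume in terms of the height function. -/
def heightWeight (ε : ℕ) (h : ℕ → ℕ → ℕ) : ℤ :=
  ∑ᶠ c : ℕ × ℕ, ((h c.1 c.2 : ℤ) - if c.2 = 0 then (ε : ℤ) else 0)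

theorem IsHeight.notMem {μ : YoungDiagram} {ε : ℕ} {h : ℕ → ℕ → ℕ} (hh : IsHeight μ ε h)
    {j k : ℕ} (hpos : 0 < h j k) : (j, k) ∉ μ := by
  intro hm
  have := hh.zero j k hm
  omega

theorem IsHeight.left_add {μ : YoungDiagram} {ε : ℕ} {h : ℕ → ℕ → ℕ} (hh : IsHeight μ ε h)
    {j k : ℕ} (hm : (j, k) ∉ μ) (d : ℕ) : h (j + d) k ≤ h j k := by
  induction d with
  | zero => simp
  | succ d ih =>
    exact (hh.left (j + d) k (YoungDiagram.notMem_mono hm (by omega) le_rfl)).trans ih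

theorem IsHeight.down_add {μ : YoungDiagram} {ε : ℕ} {h : ℕ → ℕ → ℕ} (hh : IsHeight μ ε h)
    {j k : ℕ} (hm : (j, k) ∉ μ) (d : ℕ) : h j (k + d) ≤ h j k := by
  induction d with
  | zero => simp
  | succ d ih =>
    exact (hh.down j (k + d) (YoungDiagram.notMem_mono hm le_rfl (by omega))).trans ih

theorem IsHeight.le_height {μ : YoungDiagram} {ε : ℕ} {h : ℕ → ℕ → ℕ} (hh : IsHeight μ ε h)
    {j : ℕ} (hm : (j, 0) ∉ μ) : ε ≤ h j 0 := by
  obtain ⟨N, hN⟩ := hh.row 0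
  have h1 := hh.left_add hm N
  rw [hN (j + N) (by omega)] at h1
  simpa using h1

/-- Outside a large square a height function takes its asymptotic values. -/
theorem IsHeight.exists_square {μ : YoungDiagram} {ε : ℕ} {h : ℕ → ℕ → ℕ}
    (hh : IsHeight μ ε h) :
    ∃ N, 0 < N ∧ μ.colLen 0 ≤ N ∧
      ∀ j k, (N ≤ j ∨ N ≤ k) → h j k = if k = 0 then ε else 0 := by
  obtain ⟨N₀, h₀⟩ := hh.row 0
  obtain ⟨N₁, h₁⟩ := hh.row 1
  choose c hc using hh.col
  set J := N₀ + N₁ + μ.colLen 0 with hJ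
  have key : ∀ j k, J ≤ j → h j k = if k = 0 then ε else 0 := by
    intro j k hj
    rcases k with _ | k
    · exact h₀ j (by omega)
    · have h2 := hh.down_add (j := j) (k := 1)
        (YoungDiagram.notMem_mono
          (YoungDiagram.notMem_of_colLen_le (k := 0) (by omega : μ.colLen 0 ≤ j)) le_rfl
          (by omega)) k
      rw [h₁ j (by omega)] at h2
      simp only [one_ne_zero, if_false] at h2
      rw [add_comm k 1]
      simp only [Nat.add_eq_zero_iff, one_ne_zero, false_and, if_false]
      omega
  refine ⟨J + 1 + ∑ j ∈ Finset.range J, c j, by omega, by omega, ?_⟩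
  intro j k hjk
  by_cases hj : J ≤ j
  · exact key j k hj
  · have hk : J + 1 + ∑ j ∈ Finset.range J, c j ≤ k := by omega
    have : c j ≤ ∑ j ∈ Finset.range J, c j :=
      Finset.single_le_sum (f := c) (fun _ _ => Nat.zero_le _) (Finset.mem_range.2 (by omega))
    rw [hc j k (by omega), if_neg (by omega)]

theorem heightWeight_eq_sum {ε : ℕ} {h : ℕ → ℕ → ℕ} {N : ℕ}
    (hN : ∀ j k, (N ≤ j ∨ N ≤ k) → h j k = if k = 0 then ε else 0) :
    heightWeight ε h = ∑ c ∈ Finset.range N ×ˢ Finset.range N,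
      ((h c.1 c.2 : ℤ) - if c.2 = 0 then (ε : ℤ) else 0) := by
  refine finsum_eq_sum_of_support_subset _ ?_
  intro c hc
  by_contra hn
  apply hc
  simp only [Finset.coe_product, Finset.coe_range, Set.mem_prod, Set.mem_Iio, not_and_or,
    not_lt] at hn
  simp only [hN c.1 c.2 hn]
  split_ifs <;> simp

theorem heightWeight_eq_sum_sub {ε : ℕ} {h : ℕ → ℕ → ℕ} {N : ℕ} (hpos : 0 < N)
    (hN : ∀ j k, (N ≤ j ∨ N ≤ k) → h j k = if k = 0 then ε else 0) :
    heightWeight ε h =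
      ((∑ c ∈ Finset.range N ×ˢ Finset.range N, h c.1 c.2 : ℕ) : ℤ) - ε * N := by
  rw [heightWeight_eq_sum hN, Finset.sum_sub_distrib, Nat.cast_sum]
  congr 1
  rw [Finset.sum_product]
  simp [hpos, mul_comm]

theorem heightWeight_zero_nonneg (h : ℕ → ℕ → ℕ) : 0 ≤ heightWeight 0 h :=
  finsum_nonneg fun c => by simp

theorem IsHeight.sum_le_heightWeight {μ : YoungDiagram} {h : ℕ → ℕ → ℕ} (hh : IsHeight μ 0 h)
    (s : Finset (ℕ × ℕ)) : ((∑ c ∈ s, h c.1 c.2 : ℕ) : ℤ) ≤ heightWeight 0 h := by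
  obtain ⟨N, hpos, -, hN⟩ := hh.exists_square
  rw [heightWeight_eq_sum_sub hpos hN]
  simp only [Nat.cast_zero, zero_mul, sub_zero, Nat.cast_le]
  refine Finset.sum_le_sum_of_ne_zero ?_
  intro c _ hc
  by_contra hn
  apply hc
  simp only [Finset.mem_product, Finset.mem_range, not_and_or, not_lt] at hn
  simpa using hN c.1 c.2 hn

theorem finite_isHeight_zero (μ : YoungDiagram) (n : ℤ) :
    Finite {h : ℕ → ℕ → ℕ // IsHeight μ 0 h ∧ heightWeight 0 h = n} := by
  set B := n.toNat + μ.colLen 0 + μ.rowLen 0 with hB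
  have bound : ∀ h, IsHeight μ 0 h → heightWeight 0 h = n → ∀ j k,
      h j k ≤ n.toNat ∧ (h j k ≠ 0 → j < B ∧ k < B) := by
    intro h hh hn j k
    have hle : ∀ s : Finset (ℕ × ℕ), ∑ c ∈ s, h c.1 c.2 ≤ n.toNat := by
      intro s
      have := hh.sum_le_heightWeight s
      omega
    refine ⟨by simpa using hle {(j, k)}, fun h0 => ?_⟩
    have hone : ∀ s : Finset (ℕ × ℕ), (∀ c ∈ s, c ∉ μ ∧ c.1 ≤ j ∧ c.2 ≤ k) →
        s.card ≤ n.toNat := by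
      intro s hs
      refine le_trans ?_ (hle s)
      rw [Finset.card_eq_sum_ones]
      refine Finset.sum_le_sum ?_
      rintro ⟨a, b⟩ hc
      obtain ⟨h1, h2, h3⟩ := hs _ hc
      have h4 := hh.left_add h1 (j - a)
      have h5 := hh.down_add (YoungDiagram.notMem_mono h1 h2 le_rfl) (k - b)
      simp only at h2 h3 ⊢
      rw [Nat.add_sub_cancel' h2] at h4
      rw [Nat.add_sub_cancel' h3] at h5
      omega
    constructor
    · have := hone (Finset.Ico (μ.colLen 0) (j + 1) ×ˢ {k}) (by
        rintro ⟨a, b⟩ hc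
        simp only [Finset.mem_product, Finset.mem_Ico, Finset.mem_singleton] at hc
        refine ⟨YoungDiagram.notMem_mono
          (YoungDiagram.notMem_of_colLen_le (k := 0) hc.1.1) le_rfl (Nat.zero_le _), ?_, ?_⟩
        · simp only; omega
        · simp only; omega)
      simp at this
      omega
    · have := hone ({j} ×ˢ Finset.Ico (μ.rowLen 0) (k + 1)) (by
        rintro ⟨a, b⟩ hc
        simp only [Finset.mem_product, Finset.mem_Ico, Finset.mem_singleton] at hc
        refine ⟨YoungDiagram.notMem_mono (j := 0) (k := b) ?_ (Nat.zero_le _) le_rfl, ?_, ?_⟩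
        · rw [YoungDiagram.mem_iff_lt_rowLen]; omega
        · simp only; omega
        · simp only; omega)
      simp at this
      omega
  refine Finite.of_injective (β := Fin B × Fin B → Fin (n.toNat + 1))
    (fun h x => ⟨h.1 x.1 x.2, by have := (bound h.1 h.2.1 h.2.2 x.1 x.2).1; omega⟩) ?_
  intro h h' heq
  ext j k
  by_cases hjk : j < B ∧ k < B
  · have := congrFun heq (⟨j, hjk.1⟩, ⟨k, hjk.2⟩)
    simpa using this
  · have h1 := (bound h.1 h.2.1 h.2.2 j k).2
    have h2 := (bound h'.1 h'.2.1 h'.2.2 j k).2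
    by_contra hne
    rcases Nat.eq_zero_or_pos (h.1 j k) with h3 | h3
    · exact hjk (h2 (by omega))
    · exact hjk (h1 (by omega))

/-! ### 3D partitions and height functions -/

/-- The 3D partition with a full leg over `μ` and with the given height function off `μ`. -/
def heightSet (μ : YoungDiagram) (h : ℕ → ℕ → ℕ) : Set (ℕ × ℕ × ℕ) :=
  {c | (c.2.1, c.2.2) ∈ μ ∨ c.1 < h c.2.1 c.2.2}

theorem mem_heightSet {μ : YoungDiagram} {h : ℕ → ℕ → ℕ} {i j k : ℕ} :
    (i, j, k) ∈ heightSet μ h ↔ (j, k) ∈ μ ∨ i < h j k := Iff.rfl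

theorem isAsymptotic_heightSet {μ m : YoungDiagram} {ε : ℕ}
    (hm : ∀ k i, (k, i) ∈ m ↔ k = 0 ∧ i < ε) {h : ℕ → ℕ → ℕ} (hh : IsHeight μ ε h) :
    IsAsymptotic (heightSet μ h) μ m ⊥ := by
  obtain ⟨N, hpos, hcol, hN⟩ := hh.exists_square
  refine ⟨?_, ?_, ?_, ?_⟩
  · intro i j k
    simp only [mem_heightSet]
    by_cases hjk : (j, k) ∈ μ
    · simp [hjk]
    · have h1 := hh.left j k hjk
      have h2 := hh.down j k hjk
      have h3 : (j + 1, k) ∉ μ := YoungDiagram.notMem_mono hjk (by omega) le_rfl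
      have h4 : (j, k + 1) ∉ μ := YoungDiagram.notMem_mono hjk le_rfl (by omega)
      simp only [hjk, h3, h4, false_or]
      omega
  · intro j k
    refine ⟨h j k, fun i hi => ?_⟩
    simp only [mem_heightSet]
    exact or_iff_left (by omega)
  · intro k i
    refine ⟨N, fun j hj => ?_⟩
    have h1 : (j, k) ∉ μ := YoungDiagram.notMem_mono
      (YoungDiagram.notMem_of_colLen_le (k := 0) (hcol.trans hj)) le_rfl (Nat.zero_le _)
    rw [mem_heightSet, hm, hN j k (Or.inl hj)]
    simp only [h1, false_or]
    split_ifs with hk <;> simp [hk]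
  · intro i j
    refine ⟨N + μ.rowLen 0, fun k hk => ?_⟩
    have h1 : (j, k) ∉ μ := by
      refine YoungDiagram.notMem_mono (j := 0) (k := k) ?_ (Nat.zero_le _) le_rfl
      rw [YoungDiagram.mem_iff_lt_rowLen]
      omega
    rw [mem_heightSet, hN j k (Or.inr (by omega)), if_neg (by omega)]
    simp [h1, YoungDiagram.notMem_bot]

theorem heightSet_injective {μ : YoungDiagram} {ε : ℕ} {h h' : ℕ → ℕ → ℕ}
    (hh : IsHeight μ ε h) (hh' : IsHeight μ ε h') (heq : heightSet μ h = heightSet μ h') :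
    h = h' := by
  ext j k
  by_cases hjk : (j, k) ∈ μ
  · rw [hh.zero j k hjk, hh'.zero j k hjk]
  · have key : ∀ i, i < h j k ↔ i < h' j k := by
      intro i
      have := Set.ext_iff.1 heq (i, j, k)
      simpa only [mem_heightSet, hjk, false_or] using this
    have h1 := key (h j k)
    have h2 := key (h' j k)
    omega

theorem exists_isHeight {μ m : YoungDiagram} {ε : ℕ}
    (hm : ∀ k i, (k, i) ∈ m ↔ k = 0 ∧ i < ε) {π : Set (ℕ × ℕ × ℕ)}
    (hπ : IsAsymptotic π μ m ⊥) : ∃ h, IsHeight μ ε h ∧ heightSet μ h = π := by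
  obtain ⟨hd, hl, hb, hn⟩ := hπ
  have hdi : ∀ i i' j k, i ≤ i' → (i', j, k) ∈ π → (i, j, k) ∈ π := by
    intro i i' j k hi
    induction hi with
    | refl => exact id
    | step _ ih => exact fun h => ih (hd _ _ _ (Or.inl h))
  have hfull : ∀ i j k, (j, k) ∈ μ → (i, j, k) ∈ π := by
    intro i j k hjk
    obtain ⟨N, hN⟩ := hl j k
    exact hdi i (N + i) j k (by omega) ((hN _ (by omega)).2 hjk)
  have hex : ∀ j k, ∃ a, (j, k) ∉ μ → ∀ i, (i, j, k) ∈ π ↔ i < a := by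
    intro j k
    by_cases hjk : (j, k) ∈ μ
    · exact ⟨0, fun h => absurd hjk h⟩
    · obtain ⟨N, hN⟩ := hl j k
      have he : ∃ i, (i, j, k) ∉ π := ⟨N, fun h => hjk ((hN N le_rfl).1 h)⟩
      refine ⟨Nat.find he, fun _ i => ?_⟩
      rw [Nat.lt_find_iff]
      refine ⟨fun h i' hi' => not_not.2 (hdi i' i j k hi' h), fun h => not_not.1 (h i le_rfl)⟩
  choose a ha using hex
  have hgood : ∀ i j k, (j, k) ∉ μ → ((i, j, k) ∈ π ↔ i < if (j, k) ∈ μ then 0 else a j k) := by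
    intro i j k hjk
    rw [if_neg hjk, ha j k hjk]
  refine ⟨fun j k => if (j, k) ∈ μ then 0 else a j k, ⟨?_, ?_, ?_, ?_, ?_⟩, ?_⟩
  · intro j k hjk
    exact if_pos hjk
  · intro j k hjk
    by_contra! hlt
    have h3 : (j + 1, k) ∉ μ := YoungDiagram.notMem_mono hjk (by omega) le_rfl
    have h1 := (hgood _ _ _ h3).2 hlt
    have h2 := (hgood _ _ _ hjk).1 (hd _ _ _ (Or.inr (Or.inl h1)))
    exact lt_irrefl _ h2
  · intro j k hjk
    by_contra! hlt
    have h3 : (j, k + 1) ∉ μ := YoungDiagram.notMem_mono hjk le_rfl (by omega)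
    have h1 := (hgood _ _ _ h3).2 hlt
    have h2 := (hgood _ _ _ hjk).1 (hd _ _ _ (Or.inr (Or.inr h1)))
    exact lt_irrefl _ h2
  · intro k
    choose N hN using hb k
    refine ⟨μ.colLen 0 + ∑ i ∈ Finset.range (ε + 1), N i, fun j hj => ?_⟩
    have hjk : (j, k) ∉ μ := YoungDiagram.notMem_mono
      (YoungDiagram.notMem_of_colLen_le (k := 0) (by omega : μ.colLen 0 ≤ j)) le_rfl
      (Nat.zero_le _)
    have key : ∀ i ≤ ε, (i < (if (j, k) ∈ μ then 0 else a j k) ↔ k = 0 ∧ i < ε) := by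
      intro i hi
      have : N i ≤ ∑ i ∈ Finset.range (ε + 1), N i :=
        Finset.single_le_sum (f := N) (fun _ _ => Nat.zero_le _) (Finset.mem_range.2 (by omega))
      rw [← hgood i j k hjk, hN i j (by omega), hm]
    have k1 := key ε le_rfl
    have k0 := key 0 (Nat.zero_le _)
    have k2 := key (ε - 1) (by omega)
    generalize (if (j, k) ∈ μ then 0 else a j k) = x at *
    split_ifs with hk <;> omega
  · intro j
    obtain ⟨N, hN⟩ := hn 0 j
    refine ⟨N + μ.rowLen j, fun k hk => ?_⟩
    have hjk : (j, k) ∉ μ := by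
      rw [YoungDiagram.mem_iff_lt_rowLen]
      omega
    have h1 := (hgood 0 j k hjk).2
    have h2 := (hN k (by omega)).1
    have h3 := YoungDiagram.notMem_bot (0, j)
    by_contra h4
    exact h3 (h2 (h1 (Nat.pos_of_ne_zero h4)))
  · ext ⟨i, j, k⟩
    rw [mem_heightSet]
    by_cases hjk : (j, k) ∈ μ
    · simp [hjk, hfull i j k hjk]
    · rw [hgood i j k hjk]
      simp [hjk]

theorem rvol_heightSet {μ m : YoungDiagram} {ε : ℕ}
    (hm : ∀ k i, (k, i) ∈ m ↔ k = 0 ∧ i < ε) {h : ℕ → ℕ → ℕ} (hh : IsHeight μ ε h) :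
    rvol μ m ⊥ (heightSet μ h) = heightWeight ε h := by
  obtain ⟨N, hpos, hcol, hN⟩ := hh.exists_square
  have hterm : ∀ i j k, (heightSet μ h).indicator (fun c => 1 - legCount μ m ⊥ c) (i, j, k) =
      (if i < h j k then 1 else 0) - (if i < (if k = 0 then ε else 0) then 1 else 0) := by
    intro i j k
    simp only [Set.indicator_apply, mem_heightSet, legCount, hm, YoungDiagram.notMem_bot]
    by_cases hjk : (j, k) ∈ μ
    · have := hh.zero j k hjk
      by_cases hk : k = 0
      · subst hk
        by_cases hi : i < ε <;> simp [hjk, this, hi]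
      · simp [hjk, this, hk]
    · by_cases hk : k = 0
      · subst hk
        have := hh.le_height hjk
        by_cases hi : i < h j 0 <;> by_cases hi' : i < ε <;> simp [hjk, hi, hi']
        omega
      · by_cases hi : i < h j k <;> simp [hjk, hi, hk]
  set M := ε + ∑ c ∈ Finset.range N ×ˢ Finset.range N, h c.1 c.2 with hM
  have hle : ∀ j k, h j k ≤ M := by
    intro j k
    by_cases hjk : N ≤ j ∨ N ≤ k
    · rw [hN j k hjk]
      split_ifs <;> omega
    · have : h j k ≤ ∑ c ∈ Finset.range N ×ˢ Finset.range N, h c.1 c.2 :=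
        Finset.single_le_sum (f := fun c : ℕ × ℕ => h c.1 c.2) (fun _ _ => Nat.zero_le _)
          (a := (j, k)) (by simp only [Finset.mem_product, Finset.mem_range]; omega)
      omega
  have hcount : ∀ a, a ≤ M → ∑ i ∈ Finset.range M, (if i < a then (1 : ℤ) else 0) = a := by
    intro a ha
    rw [← Finset.sum_filter, Finset.sum_const, nsmul_one]
    congr 1
    have : (Finset.range M).filter (· < a) = Finset.range a := by
      ext i
      simp only [Finset.mem_filter, Finset.mem_range]
      omega
    rw [this, Finset.card_range]
  rw [rvol, finsum_mem_def, finsum_eq_sum_of_support_subset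
    (s := Finset.range M ×ˢ (Finset.range N ×ˢ Finset.range N)), heightWeight_eq_sum hN,
    Finset.sum_product_right]
  · refine Finset.sum_congr rfl ?_
    rintro ⟨j, k⟩ _
    simp only [hterm, Finset.sum_sub_distrib]
    rw [hcount _ (hle j k), hcount _ (by split_ifs <;> omega)]
    split_ifs <;> simp
  · rintro ⟨i, j, k⟩ hc
    by_contra hn
    apply hc
    rw [hterm]
    simp only [Finset.coe_product, Finset.coe_range, Set.mem_prod, Set.mem_Iio, not_and_or,
      not_lt] at hn
    rcases hn with hi | hjk
    · have := hle j k
      rw [if_neg (by omega), if_neg (by split_ifs <;> omega), sub_zero]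
    · rw [hN j k hjk, sub_self]

theorem vertexCoeff_eq_card {μ m : YoungDiagram} {ε : ℕ}
    (hm : ∀ k i, (k, i) ∈ m ↔ k = 0 ∧ i < ε) (n : ℤ) :
    vertexCoeff μ m ⊥ n =
      (Nat.card {h : ℕ → ℕ → ℕ // IsHeight μ ε h ∧ heightWeight ε h = n} : ℚ) := by
  rw [vertexCoeff]
  congr 1
  symm
  refine Nat.card_eq_of_bijective
    (fun h => ⟨heightSet μ h.1, isAsymptotic_heightSet hm h.2.1,
      (rvol_heightSet hm h.2.1).trans h.2.2⟩) ⟨?_, ?_⟩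
  · intro h h' heq
    exact Subtype.ext (heightSet_injective h.2.1 h'.2.1 (congrArg Subtype.val heq))
  · rintro ⟨π, hπ, hvol⟩
    obtain ⟨h, hh, rfl⟩ := exists_isHeight hm hπ
    exact ⟨⟨h, hh, (rvol_heightSet hm hh).symm.trans hvol⟩, rfl⟩

/-! ### Insertion paths -/

/-- One step of a path from `x` to `y`, constrained by a height function that already includes
the path. -/
def PathStep (h : ℕ → ℕ → ℕ) (x y : ℕ × ℕ) : Prop :=
  (y.1 = x.1 ∧ x.2 = y.2 + 1 ∧ h y.1 y.2 = h x.1 x.2) ∨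
    (y.1 = x.1 + 1 ∧ y.2 = x.2 ∧ h y.1 (y.2 + 1) < h y.1 y.2)

/-- A lattice path off `μ` from the first cell of row `K` to infinity along the row `0`. -/
structure IsLatticePath (μ : YoungDiagram) (K : ℕ) (c : ℕ → ℕ × ℕ) : Prop where
  start : c 0 = (μ.colLen K, K)
  move : ∀ n, ((c (n + 1)).1 = (c n).1 ∧ (c n).2 = (c (n + 1)).2 + 1) ∨
    ((c (n + 1)).1 = (c n).1 + 1 ∧ (c (n + 1)).2 = (c n).2)
  notMem : ∀ n, c n ∉ μ
  tail : ∃ N, ∀ n ≥ N, (c n).2 = 0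

/-- A lattice path whose cells can be lowered by one in the height function `h`. -/
structure IsInsertionPath (μ : YoungDiagram) (h : ℕ → ℕ → ℕ) (K : ℕ) (c : ℕ → ℕ × ℕ) : Prop where
  start : c 0 = (μ.colLen K, K)
  terminal : h (μ.colLen K) (K + 1) < h (μ.colLen K) K
  step : ∀ n, PathStep h (c n) (c (n + 1))
  notMem : ∀ n, c n ∉ μ
  tail : ∃ N, ∀ n ≥ N, (c n).2 = 0

theorem IsInsertionPath.isLatticePath {μ : YoungDiagram} {h : ℕ → ℕ → ℕ} {K : ℕ}
    {c : ℕ → ℕ × ℕ} (hc : IsInsertionPath μ h K c) : IsLatticePath μ K c where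
  start := hc.start
  move n := by
    rcases hc.step n with ⟨h1, h2, -⟩ | ⟨h1, h2, -⟩
    · exact Or.inl ⟨h1, h2⟩
    · exact Or.inr ⟨h1, h2⟩
  notMem := hc.notMem
  tail := hc.tail

theorem IsLatticePath.diag {μ : YoungDiagram} {K : ℕ} {c : ℕ → ℕ × ℕ}
    (hc : IsLatticePath μ K c) (n : ℕ) : (c n).1 + K = μ.colLen K + n + (c n).2 := by
  induction n with
  | zero => simp [hc.start]
  | succ n ih =>
    rcases hc.move n with h | h <;> omega

theorem IsLatticePath.injective {μ : YoungDiagram} {K : ℕ} {c : ℕ → ℕ × ℕ}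
    (hc : IsLatticePath μ K c) : Function.Injective c := by
  intro n n' h
  have h1 := hc.diag n
  have h2 := hc.diag n'
  rw [h] at h1
  omega

theorem IsLatticePath.le_start {μ : YoungDiagram} {K : ℕ} {c : ℕ → ℕ × ℕ}
    (hc : IsLatticePath μ K c) (n : ℕ) : (c n).2 ≤ K := by
  induction n with
  | zero => simp [hc.start]
  | succ n ih =>
    rcases hc.move n with h | h <;> omega

theorem IsLatticePath.exists_tail {μ : YoungDiagram} {K : ℕ} {c : ℕ → ℕ × ℕ}
    (hc : IsLatticePath μ K c) :
    ∃ N, K ≤ N + μ.colLen K ∧ ∀ n ≥ N, c n = (μ.colLen K + n - K, 0) := by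
  obtain ⟨N, hN⟩ := hc.tail
  refine ⟨N + K, by omega, fun n hn => ?_⟩
  have h1 := hc.diag n
  have h2 := hN n (by omega)
  ext
  · simp only; omega
  · exact h2

/-- The indicator function of a path. -/
def pathIndicator (c : ℕ → ℕ × ℕ) (j k : ℕ) : ℕ :=
  if (j, k) ∈ Set.range c then 1 else 0

theorem pathIndicator_of_eq {c : ℕ → ℕ × ℕ} {n j k : ℕ} (h : c n = (j, k)) :
    pathIndicator c j k = 1 :=
  if_pos ⟨n, h⟩

theorem pathIndicator_cases (c : ℕ → ℕ × ℕ) (j k : ℕ) :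
    (∃ n, c n = (j, k)) ∧ pathIndicator c j k = 1 ∨
      (∀ n, c n ≠ (j, k)) ∧ pathIndicator c j k = 0 := by
  by_cases h : (j, k) ∈ Set.range c
  · exact Or.inl ⟨h, if_pos h⟩
  · exact Or.inr ⟨fun n hn => h ⟨n, hn⟩, if_neg h⟩

/-- A lattice path contains no other cell of the diagonal of one of its cells. -/
theorem IsLatticePath.not_mem_diag {μ : YoungDiagram} {K : ℕ} {c : ℕ → ℕ × ℕ}
    (hc : IsLatticePath μ K c) {n j k d : ℕ} (h : c n = (j, k)) :
    pathIndicator c (j + d + 1) (k + d + 1) = 0 := by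
  rcases pathIndicator_cases c (j + d + 1) (k + d + 1) with ⟨⟨n', h'⟩, -⟩ | ⟨-, h'⟩
  · have h1 := hc.diag n
    have h2 := hc.diag n'
    have : n = n' := by
      rw [h] at h1
      rw [h'] at h2
      simp only at h1 h2
      omega
    subst this
    rw [h] at h'
    simp only [Prod.mk.injEq] at h'
    omega
  · exact h'

/-- Beyond a lattice path, its indicator is that of the row `0`. -/
theorem IsLatticePath.exists_pathIndicator_eq {μ : YoungDiagram} {K : ℕ} {c : ℕ → ℕ × ℕ}
    (hc : IsLatticePath μ K c) :
    ∃ N, ∀ j k, (N ≤ j ∨ N ≤ k) → pathIndicator c j k = if k = 0 then 1 else 0 := by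
  obtain ⟨N, hKN, hN⟩ := hc.exists_tail
  refine ⟨μ.colLen K + N + K + 1, fun j k hjk => ?_⟩
  split_ifs with hk
  · refine pathIndicator_of_eq (n := j + K - μ.colLen K) ?_
    rw [hN _ (by omega), hk]
    ext
    · simp only; omega
    · rfl
  · rcases pathIndicator_cases c j k with ⟨⟨n, h⟩, -⟩ | ⟨-, h⟩
    · have h1 := hc.diag n
      have h2 := hc.le_start n
      rcases Nat.lt_or_ge n N with hn | hn
      · rw [h] at h1 h2
        simp only at h1 h2
        omega
      · rw [hN n hn] at h
        simp only [Prod.mk.injEq] at h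
        omega
    · exact h

/-- The number of cells of a lattice path in a large square. -/
theorem IsLatticePath.exists_sum_eq {μ : YoungDiagram} {K : ℕ} {c : ℕ → ℕ × ℕ}
    (hc : IsLatticePath μ K c) :
    ∃ N₀, ∀ N ≥ N₀,
      ((∑ x ∈ Finset.range N ×ˢ Finset.range N, pathIndicator c x.1 x.2 : ℕ) : ℤ) =
        N + K - μ.colLen K := by
  obtain ⟨M, hKM, hM⟩ := hc.exists_tail
  refine ⟨μ.colLen K + M + K + 1, fun N hN => ?_⟩
  have hcount : ∑ x ∈ Finset.range N ×ˢ Finset.range N, pathIndicator c x.1 x.2 =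
      N + K - μ.colLen K := by
    simp only [pathIndicator]
    rw [← Finset.sum_filter, ← Finset.card_eq_sum_ones]
    have himage : (Finset.range N ×ˢ Finset.range N).filter (fun x => (x.1, x.2) ∈ Set.range c) =
        (Finset.range (N + K - μ.colLen K)).image c := by
      ext x
      simp only [Finset.mem_filter, Finset.mem_product, Finset.mem_range, Prod.mk.eta,
        Set.mem_range, Finset.mem_image]
      constructor
      · rintro ⟨⟨hx1, hx2⟩, n, rfl⟩
        have := hc.diag n
        exact ⟨n, by omega, rfl⟩
      · rintro ⟨n, hn, rfl⟩
        have h1 := hc.le_start n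
        have h2 := hc.diag n
        refine ⟨⟨?_, by omega⟩, n, rfl⟩
        rcases Nat.lt_or_ge n M with hnM | hnM
        · omega
        · rw [hM n hnM]
          simp only
          omega
    rw [himage, Finset.card_image_of_injective _ hc.injective, Finset.card_range]
  rw [hcount]
  omega

theorem heightWeight_add_pathIndicator {μ : YoungDiagram} {f : ℕ → ℕ → ℕ}
    (hf : IsHeight μ 0 f) {K : ℕ} {c : ℕ → ℕ × ℕ} (hc : IsLatticePath μ K c) :
    heightWeight 1 (fun j k => f j k + pathIndicator c j k) =
      heightWeight 0 f + (K - μ.colLen K) := by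
  obtain ⟨N₁, hpos, -, h₁⟩ := hf.exists_square
  obtain ⟨N₂, h₂⟩ := hc.exists_pathIndicator_eq
  obtain ⟨N₃, h₃⟩ := hc.exists_sum_eq
  set N := N₁ + N₂ + N₃
  have hfN : ∀ j k, (N ≤ j ∨ N ≤ k) → f j k = if k = 0 then 0 else 0 :=
    fun j k hjk => h₁ j k (by omega)
  have hcN : ∀ j k, (N ≤ j ∨ N ≤ k) → pathIndicator c j k = if k = 0 then 1 else 0 :=
    fun j k hjk => h₂ j k (by omega)
  rw [heightWeight_eq_sum_sub (N := N) (by omega) hfN,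
    heightWeight_eq_sum_sub (N := N) (by omega) (fun j k hjk => ?_), Finset.sum_add_distrib,
    Nat.cast_add, h₃ N (by omega)]
  · push_cast
    ring
  · rw [hfN j k hjk, hcN j k hjk]
    split_ifs <;> rfl

/-! ### Insertion: from height functions ending at `0` to those ending at `1` -/

/-- The next cell of the insertion path, read off from the smaller height function. -/
def nextCell (μ : YoungDiagram) (f : ℕ → ℕ → ℕ) (x : ℕ × ℕ) : ℕ × ℕ :=
  if 0 < x.2 ∧ (x.1, x.2 - 1) ∉ μ ∧ f x.1 (x.2 - 1) = f x.1 x.2 then (x.1, x.2 - 1)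
  else (x.1 + 1, x.2)

/-- The insertion path starting in row `K`. -/
def insertionPath (μ : YoungDiagram) (f : ℕ → ℕ → ℕ) (K : ℕ) : ℕ → ℕ × ℕ
  | 0 => (μ.colLen K, K)
  | n + 1 => nextCell μ f (insertionPath μ f K n)

theorem insertionPath_succ_cases (μ : YoungDiagram) (f : ℕ → ℕ → ℕ) (K n : ℕ) :
    (∃ j k, insertionPath μ f K n = (j, k + 1) ∧ insertionPath μ f K (n + 1) = (j, k) ∧
      (j, k) ∉ μ ∧ f j k = f j (k + 1)) ∨
    (∃ j k, insertionPath μ f K n = (j, k) ∧ insertionPath μ f K (n + 1) = (j + 1, k) ∧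
      ∀ k', k = k' + 1 → (j, k') ∉ μ → f j k' ≠ f j k) := by
  have h : insertionPath μ f K (n + 1) = nextCell μ f (insertionPath μ f K n) := rfl
  rw [h]
  generalize insertionPath μ f K n = x
  obtain ⟨j, k⟩ := x
  unfold nextCell
  split_ifs with hx
  · obtain ⟨hk, hμ, hf⟩ := hx
    obtain ⟨k, rfl⟩ := Nat.exists_eq_add_of_lt hk
    simp only [zero_add, Nat.add_sub_cancel] at *
    exact Or.inl ⟨j, k, rfl, rfl, hμ, hf⟩
  · refine Or.inr ⟨j, k, rfl, rfl, ?_⟩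
    rintro k' rfl hμ hf
    exact hx ⟨by simp, by simpa using hμ, by simpa using hf⟩

theorem isLatticePath_insertionPath {μ : YoungDiagram} {f : ℕ → ℕ → ℕ} (hf : IsHeight μ 0 f)
    (K : ℕ) : IsLatticePath μ K (insertionPath μ f K) := by
  have hmove : ∀ n, ((insertionPath μ f K (n + 1)).1 = (insertionPath μ f K n).1 ∧
      (insertionPath μ f K n).2 = (insertionPath μ f K (n + 1)).2 + 1) ∨
      ((insertionPath μ f K (n + 1)).1 = (insertionPath μ f K n).1 + 1 ∧
        (insertionPath μ f K (n + 1)).2 = (insertionPath μ f K n).2) := by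
    intro n
    rcases insertionPath_succ_cases μ f K n with ⟨j, k, h1, h2, -⟩ | ⟨j, k, h1, h2, -⟩ <;>
      simp [h1, h2]
  have hdiag : ∀ n, (insertionPath μ f K n).1 + K =
      μ.colLen K + n + (insertionPath μ f K n).2 := by
    intro n
    induction n with
    | zero => rfl
    | succ n ih => rcases hmove n with h | h <;> omega
  refine ⟨rfl, hmove, ?_, ?_⟩
  · intro n
    induction n with
    | zero => exact YoungDiagram.notMem_of_colLen_le le_rfl
    | succ n ih =>
      rcases insertionPath_succ_cases μ f K n with ⟨j, k, h1, h2, h3, -⟩ | ⟨j, k, h1, h2, -⟩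
      · rwa [h2]
      · rw [h1] at ih
        rw [h2]
        exact YoungDiagram.notMem_mono ih (by omega) le_rfl
  · obtain ⟨N, hpos, hcol, hN⟩ := hf.exists_square
    have hdec : ∀ i, (insertionPath μ f K (N + K + i)).2 ≤ K - i := by
      intro i
      induction i with
      | zero =>
        have : ∀ n, (insertionPath μ f K n).2 ≤ K := by
          intro n
          induction n with
          | zero => exact le_rfl
          | succ n ih => rcases hmove n with h | h <;> omega
        exact this _
      | succ i ih =>
        have hd := hdiag (N + K + i)
        rcases insertionPath_succ_cases μ f K (N + K + i) with
          ⟨j, k, h1, h2, h3, -⟩ | ⟨j, k, h1, h2, h3⟩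
        · rw [h1] at ih
          rw [← add_assoc, h2]
          simp only at ih ⊢
          omega
        · rw [h1] at ih hd
          rw [← add_assoc, h2]
          simp only at ih hd ⊢
          rcases k with _ | k
          · omega
          · exfalso
            refine h3 k rfl (YoungDiagram.notMem_mono
              (YoungDiagram.notMem_of_colLen_le (k := 0) (by omega : μ.colLen 0 ≤ j)) le_rfl
              (Nat.zero_le _)) ?_
            rw [hN j k (by omega), hN j (k + 1) (by omega)]
            simp
    refine ⟨N + K + K, fun n hn => ?_⟩
    have := hdec (n - (N + K))
    rw [Nat.add_sub_cancel' (by omega)] at this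
    omega

theorem insertionPath_left {μ : YoungDiagram} {f : ℕ → ℕ → ℕ} (hf : IsHeight μ 0 f) (K : ℕ)
    {n j k : ℕ} (hn : insertionPath μ f K n = (j + 1, k)) (hjk : (j, k) ∉ μ) :
    (∃ i, insertionPath μ f K i = (j, k)) ∨ f (j + 1) k < f j k := by
  have hc := isLatticePath_insertionPath hf K
  induction n generalizing k with
  | zero =>
    simp only [insertionPath, Prod.mk.injEq] at hn
    obtain ⟨h1, rfl⟩ := hn
    exact absurd (YoungDiagram.mem_iff_lt_colLen.2 (by omega)) hjk
  | succ n ih =>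
    rcases insertionPath_succ_cases μ f K n with
      ⟨j', k', h1, h2, h3, h4⟩ | ⟨j', k', h1, h2, h3⟩
    · rw [hn, Prod.mk.injEq] at h2
      obtain ⟨rfl, rfl⟩ := h2
      have hjk' : (j, k + 1) ∉ μ := YoungDiagram.notMem_mono hjk le_rfl (by omega)
      right
      have hd := hf.down j k hjk
      rcases ih h1 hjk' with ⟨i, hi⟩ | hlt
      · have d1 := hc.diag n
        have d2 := hc.diag i
        rw [h1] at d1
        rw [hi] at d2
        simp only at d1 d2
        have hni : n = i + 1 := by omega
        subst hni
        rcases insertionPath_succ_cases μ f K i with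
          ⟨a, b, e1, e2, e3, e4⟩ | ⟨a, b, e1, e2, e3⟩
        · rw [h1] at e2
          rw [hi] at e1
          simp only [Prod.mk.injEq] at e1 e2
          omega
        · rw [hi] at e1
          simp only [Prod.mk.injEq] at e1
          obtain ⟨rfl, rfl⟩ := e1
          have := e3 k rfl hjk
          have := hf.left j (k + 1) hjk'
          omega
      · omega
    · rw [hn, Prod.mk.injEq] at h2
      obtain ⟨h5, rfl⟩ := h2
      obtain rfl : j = j' := by omega
      exact Or.inl ⟨n, h1⟩

theorem isHeight_add_insertionPath {μ : YoungDiagram} {f : ℕ → ℕ → ℕ} (hf : IsHeight μ 0 f)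
    (K : ℕ) : IsHeight μ 1 fun j k => f j k + pathIndicator (insertionPath μ f K) j k := by
  have hc := isLatticePath_insertionPath hf K
  obtain ⟨N₁, hpos, -, h₁⟩ := hf.exists_square
  obtain ⟨N₂, h₂⟩ := hc.exists_pathIndicator_eq
  refine ⟨?_, ?_, ?_, ?_, ?_⟩
  · intro j k hjk
    rcases pathIndicator_cases (insertionPath μ f K) j k with ⟨⟨n, h⟩, -⟩ | ⟨-, h⟩
    · exact absurd hjk (h ▸ hc.notMem n)
    · simp [h, hf.zero j k hjk]
  · intro j k hjk
    have hl := hf.left j k hjk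
    rcases pathIndicator_cases (insertionPath μ f K) (j + 1) k with ⟨⟨n, h⟩, h'⟩ | ⟨-, h'⟩
    · rcases insertionPath_left hf K h hjk with ⟨i, hi⟩ | hlt
      · have := pathIndicator_of_eq hi
        omega
      · omega
    · omega
  · intro j k hjk
    have hl := hf.down j k hjk
    rcases pathIndicator_cases (insertionPath μ f K) j (k + 1) with ⟨⟨n, h⟩, h'⟩ | ⟨-, h'⟩
    · rcases insertionPath_succ_cases μ f K n with
        ⟨a, b, e1, e2, e3, e4⟩ | ⟨a, b, e1, e2, e3⟩
      · rw [h, Prod.mk.injEq] at e1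
        obtain ⟨rfl, e1⟩ := e1
        obtain rfl : k = b := by omega
        have := pathIndicator_of_eq e2
        omega
      · rw [h, Prod.mk.injEq] at e1
        obtain ⟨rfl, rfl⟩ := e1
        have := e3 k rfl hjk
        omega
    · omega
  · intro k
    refine ⟨N₁ + N₂, fun j hj => ?_⟩
    rw [h₁ j k (by omega), h₂ j k (by omega)]
    split_ifs <;> rfl
  · intro j
    refine ⟨N₁ + N₂, fun k hk => ?_⟩
    rw [h₁ j k (by omega), h₂ j k (by omega), if_neg (by omega), if_neg (by omega)]

theorem isInsertionPath_insertionPath {μ : YoungDiagram} {f : ℕ → ℕ → ℕ} (hf : IsHeight μ 0 f)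
    (K : ℕ) : IsInsertionPath μ (fun j k => f j k + pathIndicator (insertionPath μ f K) j k) K
      (insertionPath μ f K) := by
  have hc := isLatticePath_insertionPath hf K
  refine ⟨rfl, ?_, ?_, hc.notMem, hc.tail⟩
  · have h1 : pathIndicator (insertionPath μ f K) (μ.colLen K) K = 1 :=
      pathIndicator_of_eq (n := 0) rfl
    have h2 := hf.down (μ.colLen K) K (YoungDiagram.notMem_of_colLen_le le_rfl)
    rcases pathIndicator_cases (insertionPath μ f K) (μ.colLen K) (K + 1) with
      ⟨⟨n, h⟩, -⟩ | ⟨-, h⟩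
    · have := hc.le_start n
      rw [h] at this
      simp only at this
      omega
    · omega
  · intro n
    rcases insertionPath_succ_cases μ f K n with
      ⟨j, k, e1, e2, e3, e4⟩ | ⟨j, k, e1, e2, e3⟩
    · left
      have h1 := pathIndicator_of_eq e1
      have h2 := pathIndicator_of_eq e2
      rw [e1, e2]
      refine ⟨rfl, rfl, ?_⟩
      simp only
      omega
    · right
      have h1 := hc.not_mem_diag (d := 0) e1
      have h2 := pathIndicator_of_eq e2
      have h3 := hf.down (j + 1) k (e2 ▸ hc.notMem (n + 1))
      rw [e1, e2]
      refine ⟨rfl, rfl, ?_⟩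
      simp only [add_zero] at h1 ⊢
      omega

/-! ### The insertion path is determined by the larger height function -/

theorem IsInsertionPath.pred_unique {μ : YoungDiagram} {h : ℕ → ℕ → ℕ} {K K' : ℕ}
    {c c' : ℕ → ℕ × ℕ} (hc : IsInsertionPath μ h K c) (hc' : IsInsertionPath μ h K' c') {n n' : ℕ}
    (heq : c (n + 1) = c' (n' + 1)) : c n = c' n' := by
  have h1 := hc.step n
  have h2 := hc'.step n'
  rw [← heq] at h2
  generalize c (n + 1) = y at h1 h2
  generalize c n = x at h1
  generalize c' n' = x' at h2
  obtain ⟨y₁, y₂⟩ := y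
  obtain ⟨x₁, x₂⟩ := x
  obtain ⟨z₁, z₂⟩ := x'
  simp only [PathStep] at h1 h2
  rw [Prod.mk.injEq]
  rcases h1 with ⟨rfl, rfl, h1⟩ | ⟨h3, rfl, h1⟩ <;> rcases h2 with ⟨rfl, rfl, h2⟩ | ⟨h4, rfl, h2⟩ <;>
    omega

theorem IsInsertionPath.start_ne_succ {μ : YoungDiagram} {h : ℕ → ℕ → ℕ} {K K' : ℕ}
    {c c' : ℕ → ℕ × ℕ} (hc : IsInsertionPath μ h K c) (hc' : IsInsertionPath μ h K' c') (n : ℕ) :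
    c 0 ≠ c' (n + 1) := by
  intro heq
  have h1 := hc.terminal
  have h2 := hc'.step n
  have h3 := hc'.notMem n
  rw [← heq, hc.start] at h2
  generalize c' n = x at h2 h3
  obtain ⟨x₁, x₂⟩ := x
  simp only [PathStep] at h2
  rcases h2 with ⟨rfl, rfl, h2⟩ | ⟨h4, rfl, h2⟩
  · omega
  · rw [YoungDiagram.mem_iff_lt_colLen] at h3
    omega

theorem IsInsertionPath.index_unique {μ : YoungDiagram} {h : ℕ → ℕ → ℕ} {K K' : ℕ}
    {c c' : ℕ → ℕ × ℕ} (hc : IsInsertionPath μ h K c) (hc' : IsInsertionPath μ h K' c') {n n' : ℕ}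
    (heq : c n = c' n') : K = K' ∧ n = n' := by
  induction n generalizing n' with
  | zero =>
    rcases n' with _ | n'
    · rw [hc.start, hc'.start, Prod.mk.injEq] at heq
      exact ⟨heq.2, rfl⟩
    · exact absurd heq (hc.start_ne_succ hc' n')
  | succ n ih =>
    rcases n' with _ | n'
    · exact absurd heq.symm (hc'.start_ne_succ hc n)
    · obtain ⟨h1, h2⟩ := ih (hc.pred_unique hc' heq)
      exact ⟨h1, by rw [h2]⟩

theorem IsInsertionPath.unique {μ : YoungDiagram} {h : ℕ → ℕ → ℕ} {K K' : ℕ}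
    {c c' : ℕ → ℕ × ℕ} (hc : IsInsertionPath μ h K c) (hc' : IsInsertionPath μ h K' c') :
    K = K' ∧ c = c' := by
  obtain ⟨N, hKN, hN⟩ := hc.isLatticePath.exists_tail
  obtain ⟨N', hKN', hN'⟩ := hc'.isLatticePath.exists_tail
  have hK : K = K' := by
    refine (hc.index_unique hc' (n := N + N' + K + μ.colLen K')
      (n' := N + N' + μ.colLen K + K') ?_).1
    rw [hN _ (by omega), hN' _ (by omega), Prod.mk.injEq]
    omega
  subst hK
  refine ⟨rfl, funext fun n => ?_⟩
  have hback : ∀ m n, c (n + m) = c' (n + m) → c n = c' n := by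
    intro m
    induction m with
    | zero => exact fun n h => h
    | succ m ih => exact fun n h => ih n (hc.pred_unique hc' h)
  refine hback (N + N') n ?_
  rw [hN _ (by omega), hN' _ (by omega)]

/-! ### Removal: from height functions ending at `1` to those ending at `0` -/

theorem IsHeight.exists_partial_path {μ : YoungDiagram} {h : ℕ → ℕ → ℕ} (hh : IsHeight μ 1 h)
    {N : ℕ} (hpos : 0 < N) (hN : ∀ j k, (N ≤ j ∨ N ≤ k) → h j k = if k = 0 then 1 else 0)
    (s : ℕ) : ∀ j k, j + N ≤ s + k → 0 < h j k →
    ∃ (K m : ℕ) (c : ℕ → ℕ × ℕ), c 0 = (μ.colLen K, K) ∧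
      h (μ.colLen K) (K + 1) < h (μ.colLen K) K ∧ c m = (j, k) ∧
      (∀ n < m, PathStep h (c n) (c (n + 1))) ∧ ∀ n ≤ m, c n ∉ μ := by
  induction s with
  | zero =>
    intro j k hs h0
    rw [hN j k (by omega), if_neg (by omega)] at h0
    exact absurd h0 (lt_irrefl _)
  | succ s ih =>
    intro j k hs h0
    have hjk := hh.notMem h0
    have extend : ∀ j' k', 0 < h j' k' → j' + N ≤ s + k' → PathStep h (j', k') (j, k) →
        ∃ (K m : ℕ) (c : ℕ → ℕ × ℕ), c 0 = (μ.colLen K, K) ∧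
          h (μ.colLen K) (K + 1) < h (μ.colLen K) K ∧ c m = (j, k) ∧
          (∀ n < m, PathStep h (c n) (c (n + 1))) ∧ ∀ n ≤ m, c n ∉ μ := by
      intro j' k' h0' hs' hstep
      obtain ⟨K, m, c, hc0, hterminal, hcm, hcstep, hcμ⟩ := ih j' k' hs' h0'
      refine ⟨K, m + 1, fun n => if n ≤ m then c n else (j, k), ?_, hterminal, ?_, ?_, ?_⟩
      · simpa using hc0
      · simp
      · intro n hn
        rcases Nat.lt_or_ge n m with hnm | hnm
        · simpa only [if_pos hnm.le, if_pos (Nat.succ_le_of_lt hnm)] using hcstep n hnm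
        · obtain rfl : n = m := by omega
          simpa [hcm] using hstep
      · intro n hn
        rcases Nat.lt_or_ge m n with hnm | hnm
        · simpa only [if_neg (Nat.not_le.2 hnm)] using hjk
        · simpa only [if_pos hnm] using hcμ n hnm
    by_cases heq : h j k = h j (k + 1)
    · exact extend j (k + 1) (by omega) (by omega) (Or.inl ⟨rfl, rfl, heq⟩)
    · have hlt : h j (k + 1) < h j k := lt_of_le_of_ne (hh.down j k hjk) (Ne.symm heq)
      by_cases hj : j = μ.colLen k
      · subst hj
        exact ⟨k, 0, fun _ => (μ.colLen k, k), rfl, hlt, rfl, fun n hn => absurd hn (by omega),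
          fun _ _ => hjk⟩
      · rw [YoungDiagram.mem_iff_lt_colLen] at hjk
        obtain ⟨j, rfl⟩ : ∃ i, j = i + 1 := ⟨j - 1, by omega⟩
        have hl := hh.left j k (YoungDiagram.notMem_of_colLen_le (by omega))
        exact extend j k (by omega) (by omega) (Or.inr ⟨rfl, rfl, hlt⟩)

theorem IsHeight.exists_isInsertionPath {μ : YoungDiagram} {h : ℕ → ℕ → ℕ}
    (hh : IsHeight μ 1 h) : ∃ K c, IsInsertionPath μ h K c := by
  obtain ⟨N, hpos, hcol, hN⟩ := hh.exists_square
  obtain ⟨K, m, c, hc0, hterminal, hcm, hcstep, hcμ⟩ :=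
    hh.exists_partial_path hpos hN (N + N) N 0 (by omega) (by simp [hN N 0])
  have key : ∀ n, m ≤ n → (if n ≤ m then c n else (N + (n - m), 0)) = (N + (n - m), 0) := by
    intro n hn
    split_ifs with h
    · obtain rfl : n = m := by omega
      simp [hcm]
    · rfl
  refine ⟨K, fun n => if n ≤ m then c n else (N + (n - m), 0), ?_, hterminal, ?_, ?_, ?_⟩
  · simpa using hc0
  · intro n
    rcases Nat.lt_or_ge n m with hnm | hnm
    · simpa only [if_pos hnm.le, if_pos (Nat.succ_le_of_lt hnm)] using hcstep n hnm
    · simp only [key n hnm, key (n + 1) (by omega)]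
      refine Or.inr ⟨by simp only; omega, rfl, ?_⟩
      simp only
      rw [hN _ _ (by omega), hN _ _ (by omega)]
      simp
  · intro n
    rcases Nat.lt_or_ge n m with hnm | hnm
    · simpa only [if_pos hnm.le] using hcμ n hnm.le
    · simp only [key n hnm]
      exact YoungDiagram.notMem_of_colLen_le (by omega)
  · exact ⟨m, fun n hn => by simp only [key n hn]⟩

theorem IsInsertionPath.height_pos {μ : YoungDiagram} {h : ℕ → ℕ → ℕ} {K : ℕ}
    {c : ℕ → ℕ × ℕ} (hh : IsHeight μ 1 h) (hc : IsInsertionPath μ h K c) (n : ℕ) :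
    0 < h (c n).1 (c n).2 := by
  have hle : ∀ n, h (c (n + 1)).1 (c (n + 1)).2 ≤ h (c n).1 (c n).2 := by
    intro n
    rcases hc.step n with ⟨-, -, h3⟩ | ⟨h1, h2, -⟩
    · exact h3.le
    · rw [h1, h2]
      exact hh.left _ _ (hc.notMem n)
  have hanti := antitone_nat_of_succ_le (f := fun n => h (c n).1 (c n).2) hle
  obtain ⟨N, hN⟩ := hc.tail
  refine lt_of_lt_of_le ?_ (hanti (Nat.le_add_right n N))
  simp only
  have h1 := hc.notMem (n + N)
  have h2 := hN (n + N) (by omega)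
  rw [← Prod.mk.eta (p := c (n + N)), h2] at h1
  rw [h2]
  exact hh.le_height h1

theorem IsInsertionPath.left {μ : YoungDiagram} {h : ℕ → ℕ → ℕ} {K : ℕ}
    {c : ℕ → ℕ × ℕ} (hh : IsHeight μ 1 h) (hc : IsInsertionPath μ h K c) {n j k : ℕ}
    (hn : c n = (j, k)) : (∃ i, c i = (j + 1, k)) ∨ h (j + 1) k < h j k := by
  obtain ⟨N, hKN, hN⟩ := hc.isLatticePath.exists_tail
  have main : ∀ d n j k, N ≤ n + d → c n = (j, k) →
      (∃ i, c i = (j + 1, k)) ∨ h (j + 1) k < h j k := by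
    intro d
    induction d with
    | zero =>
      intro n j k hd hn
      left
      refine ⟨n + 1, ?_⟩
      rw [hN n (by omega), Prod.mk.injEq] at hn
      rw [hN (n + 1) (by omega), Prod.mk.injEq]
      omega
    | succ d ih =>
      intro n j k hd hn
      have hs := hc.step n
      obtain ⟨a, b, hab⟩ : ∃ a b, c (n + 1) = (a, b) := ⟨_, _, rfl⟩
      rw [hn, hab] at hs
      simp only [PathStep] at hs
      rcases hs with ⟨rfl, rfl, h3⟩ | ⟨rfl, rfl, h3⟩
      · right
        have hμ : (a, b) ∉ μ := hab ▸ hc.notMem (n + 1)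
        have hμ' : (a + 1, b) ∉ μ := YoungDiagram.notMem_mono hμ (by omega) le_rfl
        have hd := hh.down (a + 1) b hμ'
        rcases ih (n + 1) a b (by omega) hab with ⟨i, hi⟩ | hlt
        · have d1 := hc.isLatticePath.diag (n + 1)
          have d2 := hc.isLatticePath.diag i
          rw [hab] at d1
          rw [hi] at d2
          simp only at d1 d2
          obtain rfl : i = n + 1 + 1 := by omega
          have hs := hc.step (n + 1)
          rw [hab, hi] at hs
          simp only [PathStep] at hs
          have := hh.left a b hμ
          omega
        · omega
      · exact Or.inl ⟨n + 1, hab⟩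
  exact main N n j k (by omega) hn

theorem IsInsertionPath.isHeight_sub {μ : YoungDiagram} {h : ℕ → ℕ → ℕ} {K : ℕ}
    {c : ℕ → ℕ × ℕ} (hh : IsHeight μ 1 h) (hc : IsInsertionPath μ h K c) :
    IsHeight μ 0 fun j k => h j k - pathIndicator c j k := by
  obtain ⟨N₁, hpos, -, h₁⟩ := hh.exists_square
  obtain ⟨N₂, h₂⟩ := hc.isLatticePath.exists_pathIndicator_eq
  refine ⟨?_, ?_, ?_, ?_, ?_⟩
  · intro j k hjk
    simp [hh.zero j k hjk]
  · intro j k hjk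
    have hl := hh.left j k hjk
    rcases pathIndicator_cases c j k with ⟨⟨n, h⟩, h'⟩ | ⟨-, h'⟩
    · rcases hc.left hh h with ⟨i, hi⟩ | hlt
      · have := pathIndicator_of_eq hi
        omega
      · omega
    · omega
  · intro j k hjk
    have hl := hh.down j k hjk
    rcases pathIndicator_cases c j k with ⟨⟨n, h⟩, h'⟩ | ⟨-, h'⟩
    · rcases n with _ | n
      · rw [hc.start, Prod.mk.injEq] at h
        obtain ⟨rfl, rfl⟩ := h
        have := hc.terminal
        omega
      · have hs := hc.step n
        obtain ⟨a, b, hab⟩ : ∃ a b, c n = (a, b) := ⟨_, _, rfl⟩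
        rw [h, hab] at hs
        simp only [PathStep] at hs
        rcases hs with ⟨rfl, rfl, h3⟩ | ⟨rfl, rfl, h3⟩
        · have := pathIndicator_of_eq hab
          omega
        · omega
    · omega
  · intro k
    refine ⟨N₁ + N₂, fun j hj => ?_⟩
    rw [h₁ j k (by omega), h₂ j k (by omega)]
    split_ifs <;> rfl
  · intro j
    refine ⟨N₁ + N₂, fun k hk => ?_⟩
    rw [h₁ j k (by omega), h₂ j k (by omega), if_neg (by omega)]

theorem IsInsertionPath.sub_add {μ : YoungDiagram} {h : ℕ → ℕ → ℕ} {K : ℕ}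
    {c : ℕ → ℕ × ℕ} (hh : IsHeight μ 1 h) (hc : IsInsertionPath μ h K c) (j k : ℕ) :
    h j k - pathIndicator c j k + pathIndicator c j k = h j k := by
  rcases pathIndicator_cases c j k with ⟨⟨n, h1⟩, h2⟩ | ⟨-, h2⟩
  · have := hc.height_pos hh n
    rw [h1] at this
    simp only at this
    omega
  · omega

theorem IsInsertionPath.insertionPath_sub {μ : YoungDiagram} {h : ℕ → ℕ → ℕ} {K : ℕ}
    {c : ℕ → ℕ × ℕ} (hh : IsHeight μ 1 h) (hc : IsInsertionPath μ h K c) :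
    insertionPath μ (fun j k => h j k - pathIndicator c j k) K = c := by
  have hf := hc.isHeight_sub hh
  have hadd := hc.sub_add hh
  set f : ℕ → ℕ → ℕ := fun j k => h j k - pathIndicator c j k with hfdef
  replace hadd : ∀ j k, f j k + pathIndicator c j k = h j k := hadd
  funext n
  induction n with
  | zero => exact hc.start.symm
  | succ n ih =>
    have hs := hc.step n
    obtain ⟨a, b, hab⟩ : ∃ a b, c (n + 1) = (a, b) := ⟨_, _, rfl⟩
    have iab := pathIndicator_of_eq hab
    have hμ := hc.notMem (n + 1)
    have fab := hadd a b
    rcases insertionPath_succ_cases μ f K n with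
      ⟨j, k, e1, e2, e3, e4⟩ | ⟨j, k, e1, e2, e3⟩
    · rw [e2, hab, Prod.mk.injEq]
      rw [e1] at ih
      rw [← ih, hab] at hs
      have i1 := pathIndicator_of_eq ih.symm
      simp only [PathStep] at hs
      rcases hs with ⟨rfl, h2, h3⟩ | ⟨rfl, rfl, h3⟩
      · omega
      · exfalso
        have f1 := hadd j (k + 1)
        have f2 := hadd j k
        have : pathIndicator c j k = 0 := by
          rcases pathIndicator_cases c j k with ⟨⟨i, hi⟩, -⟩ | ⟨-, h'⟩
          · have := hc.isLatticePath.not_mem_diag (d := 0) hi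
            simp only [add_zero] at this
            omega
          · exact h'
        have f3 := hh.left j (k + 1) (ih ▸ hc.notMem n)
        have f4 := hh.down j k e3
        omega
    · rw [e2, hab, Prod.mk.injEq]
      rw [e1] at ih
      rw [← ih, hab] at hs
      have i1 := pathIndicator_of_eq ih.symm
      simp only [PathStep] at hs
      rcases hs with ⟨rfl, rfl, h3⟩ | ⟨rfl, rfl, h3⟩
      · exfalso
        refine e3 b rfl (hab ▸ hμ) ?_
        have f1 := hadd a (b + 1)
        omega
      · exact ⟨rfl, rfl⟩

/-! ### Coefficients and generating functions -/

theorem YoungDiagram.colLen_eq_zero_of_rowLen_le {μ : YoungDiagram} {K : ℕ}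
    (h : μ.rowLen 0 ≤ K) : μ.colLen K = 0 := by
  by_contra h0
  have h1 : (0, K) ∈ μ := YoungDiagram.mem_iff_lt_colLen.2 (Nat.pos_of_ne_zero h0)
  rw [YoungDiagram.mem_iff_lt_rowLen] at h1
  omega

theorem mem_bot_iff (k i : ℕ) : (k, i) ∈ (⊥ : YoungDiagram) ↔ k = 0 ∧ i < 0 := by
  simp [YoungDiagram.notMem_bot]

theorem mem_box_iff (k i : ℕ) : (k, i) ∈ box ↔ k = 0 ∧ i < 1 := by
  have h : (k, i) ∈ box ↔ (k, i) ∈ ({(0, 0)} : Finset (ℕ × ℕ)) := Iff.rfl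
  rw [h, Finset.mem_singleton, Prod.mk.injEq, Nat.lt_one_iff]

/-- Adding insertion paths is a bijection from pairs of a height function ending at `0` and a
starting row to height functions ending at `1`. -/
theorem card_isHeight_one (μ : YoungDiagram) {n : ℤ} {M : ℕ} (hM : μ.rowLen 0 ≤ M) (hn : n < M) :
    Nat.card {h : ℕ → ℕ → ℕ // IsHeight μ 1 h ∧ heightWeight 1 h = n} =
      ∑ K : Fin M, Nat.card {f : ℕ → ℕ → ℕ //
        IsHeight μ 0 f ∧ heightWeight 0 f = n - ((K : ℕ) - μ.colLen K)} := by
  have : ∀ K : Fin M, Finite {f : ℕ → ℕ → ℕ //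
      IsHeight μ 0 f ∧ heightWeight 0 f = n - ((K : ℕ) - μ.colLen K)} :=
    fun K => finite_isHeight_zero μ _
  rw [← Nat.card_sigma]
  symm
  refine Nat.card_eq_of_bijective
    (fun x => ⟨fun j k => x.2.1 j k + pathIndicator (insertionPath μ x.2.1 x.1) j k,
      isHeight_add_insertionPath x.2.2.1 x.1, by
        rw [heightWeight_add_pathIndicator x.2.2.1 (isLatticePath_insertionPath x.2.2.1 x.1),
          x.2.2.2]
        ring⟩) ⟨?_, ?_⟩
  · rintro ⟨K, f, hf, hfw⟩ ⟨K', f', hf', hfw'⟩ heq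
    have heq' := congrArg Subtype.val heq
    simp only at heq'
    have h1 := isInsertionPath_insertionPath hf K
    have h2 := isInsertionPath_insertionPath hf' K'
    rw [← heq'] at h2
    obtain ⟨hK, hc⟩ := h1.unique h2
    obtain rfl := Fin.ext hK
    have hff : f = f' := by
      ext j k
      have := congrFun (congrFun heq' j) k
      rw [hc] at this
      exact Nat.add_right_cancel this
    subst hff
    rfl
  · rintro ⟨h, hh, hw⟩
    obtain ⟨K, c, hc⟩ := hh.exists_isInsertionPath
    have hf := hc.isHeight_sub hh
    have hadd : (fun j k => h j k - pathIndicator c j k + pathIndicator c j k) = h := by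
      ext j k
      exact hc.sub_add hh j k
    have hweight := heightWeight_add_pathIndicator hf hc.isLatticePath
    rw [hadd, hw] at hweight
    have hKM : K < M := by
      by_contra hK
      have h0 := heightWeight_zero_nonneg fun j k => h j k - pathIndicator c j k
      rw [YoungDiagram.colLen_eq_zero_of_rowLen_le (by omega)] at hweight
      omega
    refine ⟨⟨⟨K, hKM⟩, ⟨_, hf, by simp only; omega⟩⟩, Subtype.ext ?_⟩
    simp only
    rw [hc.insertionPath_sub hh]
    exact hadd

theorem vertexCoeff_box (μ : YoungDiagram) {n : ℤ} {M : ℕ} (hM : μ.rowLen 0 ≤ M) (hn : n < M) :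
    vertexCoeff μ box ⊥ n =
      ∑ K ∈ Finset.range M, vertexCoeff μ ⊥ ⊥ (n - ((K : ℤ) - μ.colLen K)) := by
  rw [vertexCoeff_eq_card mem_box_iff, card_isHeight_one μ hM hn, Nat.cast_sum,
    Finset.sum_range]
  exact Finset.sum_congr rfl fun K _ => (vertexCoeff_eq_card mem_bot_iff _).symm

theorem vertexCoeff_bot_of_neg (μ : YoungDiagram) {n : ℤ} (hn : n < 0) :
    vertexCoeff μ ⊥ ⊥ n = 0 := by
  rw [vertexCoeff_eq_card mem_bot_iff]
  have : IsEmpty {h : ℕ → ℕ → ℕ // IsHeight μ 0 h ∧ heightWeight 0 h = n} :=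
    ⟨fun h => by
      have h1 := heightWeight_zero_nonneg h.1
      have h2 := h.2.2
      omega⟩
  simp

theorem vertexCoeff_box_of_lt (μ : YoungDiagram) {n : ℤ} (hn : n < -μ.colLen 0) :
    vertexCoeff μ box ⊥ n = 0 := by
  rw [vertexCoeff_box μ le_rfl (by omega)]
  refine Finset.sum_eq_zero fun K _ => vertexCoeff_bot_of_neg μ ?_
  have := μ.colLen_anti 0 K (Nat.zero_le K)
  omega

theorem vertex_coeff_of_bddBelow {l m n : YoungDiagram} {a : ℤ}
    (h : ∀ k < a, vertexCoeff l m n k = 0) (k : ℤ) :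
    (vertex l m n).coeff k = vertexCoeff l m n k := by
  have hpwo : (Function.support (vertexCoeff l m n)).IsPWO := by
    rw [Set.isPWO_iff_isWF]
    refine BddBelow.isWF ⟨a, fun k hk => ?_⟩
    by_contra hlt
    exact hk (h k (not_le.1 hlt))
  rw [vertex, dif_pos hpwo]

theorem vertex_bot_coeff (μ : YoungDiagram) (n : ℤ) :
    (vertex μ ⊥ ⊥).coeff n = vertexCoeff μ ⊥ ⊥ n :=
  vertex_coeff_of_bddBelow (fun _ hk => vertexCoeff_bot_of_neg μ hk) n

theorem vertex_bot_eq_ofPowerSeries (μ : YoungDiagram) :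
    vertex μ ⊥ ⊥ =
      HahnSeries.ofPowerSeries ℤ ℚ (PowerSeries.mk fun n : ℕ => vertexCoeff μ ⊥ ⊥ n) := by
  ext n
  rw [vertex_bot_coeff, PowerSeries.coeff_coe, PowerSeries.coeff_mk]
  split_ifs with hn
  · exact vertexCoeff_bot_of_neg μ hn
  · rw [Int.natAbs_of_nonneg (not_lt.1 hn)]

theorem Kp_zpow (n : ℤ) : Kp ^ n = HahnSeries.single n 1 :=
  (RatFunc.single_zpow n).symm

theorem ofPowerSeries_mk_one_mul :
    HahnSeries.ofPowerSeries ℤ ℚ (PowerSeries.mk 1) * (1 - Kp) = 1 := by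
  have h := congrArg (HahnSeries.ofPowerSeries ℤ ℚ) (PowerSeries.mk_one_mul_one_sub_eq_one ℚ)
  rwa [map_mul, map_sub, map_one, HahnSeries.ofPowerSeries_X] at h

theorem one_sub_Kp_inv : (1 - Kp)⁻¹ = HahnSeries.ofPowerSeries ℤ ℚ (PowerSeries.mk 1) :=
  inv_eq_of_mul_eq_one_left ofPowerSeries_mk_one_mul

/-- Moving finitely many terms out of the geometric tail. -/
theorem geometric_tail_eq (μ : YoungDiagram) {M : ℕ} (hM : μ.rowLen 0 ≤ M) :
    (∑ j ∈ Finset.range (μ.rowLen 0), Kp ^ ((j : ℤ) - (μ.colLen j : ℤ))) +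
        Kp ^ μ.rowLen 0 * (1 - Kp)⁻¹ =
      (∑ j ∈ Finset.range M, Kp ^ ((j : ℤ) - (μ.colLen j : ℤ))) + Kp ^ M * (1 - Kp)⁻¹ := by
  induction M, hM using Nat.le_induction with
  | base => rfl
  | succ M hM ih =>
    have h : (1 - Kp)⁻¹ = 1 + Kp * (1 - Kp)⁻¹ := by
      rw [one_sub_Kp_inv]
      linear_combination ofPowerSeries_mk_one_mul
    rw [ih, Finset.sum_range_succ, YoungDiagram.colLen_eq_zero_of_rowLen_le hM, Nat.cast_zero,
      sub_zero, zpow_natCast, pow_succ]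
    linear_combination Kp ^ M * h

theorem coeff_vertex_mul_tail (μ : YoungDiagram) {n : ℤ} {M : ℕ} (hn : n < M) :
    (vertex μ ⊥ ⊥ * (Kp ^ M * (1 - Kp)⁻¹)).coeff n = 0 := by
  rw [vertex_bot_eq_ofPowerSeries, one_sub_Kp_inv, mul_left_comm, ← map_mul, ← zpow_natCast,
    Kp_zpow, HahnSeries.coeff_single_mul, PowerSeries.coeff_coe, if_pos (by omega), mul_zero]

/-- For every partition λ (with parts λ_i = colLen (i−1) and
ℓ = rowLen 0 nonzero parts),
  V_{λ□∅}(p) = V_{λ∅∅}(p) · ( Σ_{i=1}^{ℓ} p^{−λ_i+i−1} + Σ_{m=ℓ}^∞ p^m ),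
where Σ_{m≥ℓ} p^m = p^ℓ·(1−p)^{−1} is the Laurent expansion of the geometric tail. -/
theorem statement4 (μ : YoungDiagram) :
    vertex μ box ⊥ =
      vertex μ ⊥ ⊥ *
        ((∑ j ∈ Finset.range (μ.rowLen 0), Kp ^ ((j : ℤ) - (μ.colLen j : ℤ))) +
          Kp ^ μ.rowLen 0 * (1 - Kp)⁻¹) := by

  ext n
  have hM : μ.rowLen 0 ≤ μ.rowLen 0 + (n.toNat + 1) := Nat.le_add_right _ _
  have hn : n < (μ.rowLen 0 + (n.toNat + 1) : ℕ) := by omega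
  rw [vertex_coeff_of_bddBelow (fun _ hk => vertexCoeff_box_of_lt μ hk), vertexCoeff_box μ hM hn,
    geometric_tail_eq μ hM, mul_add, HahnSeries.coeff_add, coeff_vertex_mul_tail μ hn, add_zero,
    Finset.mul_sum, HahnSeries.coeff_sum]
  refine Finset.sum_congr rfl fun K _ => ?_
  rw [Kp_zpow, HahnSeries.coeff_mul_single, mul_one, vertex_bot_coeff]
end
end

section
/- Let V_{λμν}(p) be the topological vertex. For every partition λ, p · V_{λ□□}(p) = V_{λ∅∅}(p) · ι( 1 − p·G(λ)·H(λ) ) in ℚ((p)), where ι : ℚ(p) → ℚ((p)) is the Laurent series expansion at p = 0, and G(λ), H(λ) ∈ ℚ(p) are the regularized sums defined in the context. (Equivalently, p·V_{λ□□}/V_{λ∅∅} = 1 − (Σ_{i≥1} p^{−λ_i+i−1/2})(Σ_{j≥1} p^{λ_j−j+1/2}) with both divergent geometric tails summed as rational functions.) -/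
noncomputable section

open scoped Classical

/-- The regularized sum G(λ) = Σ_{i=1}^{ℓ} p^{−λ_i+i−1} + p^{ℓ}/(1−p) ∈ ℚ(p),
the regularization of Σ_{i≥1} p^{−λ_i+i−1}.  Here the parts of λ are
λ_i = colLen (i−1) and ℓ = rowLen 0 is the number of nonzero parts. -/
def Gfun (μ : YoungDiagram) : RatFunc ℚ :=
  (∑ j ∈ Finset.range (μ.rowLen 0), RatFunc.X ^ j * (RatFunc.X ^ μ.colLen j)⁻¹) +
    RatFunc.X ^ μ.rowLen 0 * (1 - RatFunc.X)⁻¹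

/-- The regularized sum H(λ) = Σ_{i=1}^{ℓ} p^{λ_i−i} + p^{−ℓ}/(p−1) ∈ ℚ(p),
the regularization of Σ_{i≥1} p^{λ_i−i}. -/
def Hfun (μ : YoungDiagram) : RatFunc ℚ :=
  (∑ j ∈ Finset.range (μ.rowLen 0), RatFunc.X ^ μ.colLen j * (RatFunc.X ^ (j + 1))⁻¹) +
    (RatFunc.X ^ μ.rowLen 0)⁻¹ * (RatFunc.X - 1)⁻¹

/-- `A` interlaces `B` from above: `A 0 ≥ B 0 ≥ A 1 ≥ B 1 ≥ ⋯`. -/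
def Above (A B : ℕ →₀ ℕ) : Prop := ∀ i, B i ≤ A i ∧ A (i + 1) ≤ B i

lemma Above.antitone_left {A B : ℕ →₀ ℕ} (h : Above A B) : Antitone A :=
  antitone_nat_of_succ_le fun i => (h i).2.trans (h i).1

lemma Above.antitone_right {A B : ℕ →₀ ℕ} (h : Above A B) : Antitone B :=
  antitone_nat_of_succ_le fun i => (h (i + 1)).1.trans (h i).2

lemma add_single_apply (A : ℕ →₀ ℕ) (i k : ℕ) :
    (A + Finsupp.single i 1 : ℕ →₀ ℕ) k = A k + if k = i then 1 else 0 := by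
  simp [Finsupp.single_apply, eq_comm]

lemma sub_single_apply (A : ℕ →₀ ℕ) (i k : ℕ) :
    (A - Finsupp.single i 1 : ℕ →₀ ℕ) k = A k - if k = i then 1 else 0 := by
  simp [Finsupp.single_apply, eq_comm]

lemma above_add_single_zero {A B : ℕ →₀ ℕ} (h : Above A B) :
    Above (A + Finsupp.single 0 1) B := by
  intro k
  have := h k
  simp only [add_single_apply]
  grind

lemma above_add_single_succ_iff {A B : ℕ →₀ ℕ} (h : Above A B) (i : ℕ) :
    Above (A + Finsupp.single (i + 1) 1) B ↔ 0 < B i ∧ Above A (B - Finsupp.single i 1) := by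
  simp only [Above, add_single_apply, sub_single_apply] at *
  constructor
  · intro H
    have h1 := H i
    refine ⟨by grind, fun k => ?_⟩
    have := h k
    have := H k
    grind
  · rintro ⟨h0, H⟩ k
    have := h k
    have := H k
    grind

lemma above_add_single_iff_of_not {A B : ℕ →₀ ℕ} (hA : Antitone A) (hB : Antitone B)
    (h : ¬ Above A B) (i : ℕ) :
    Above (A + Finsupp.single i 1) B ↔ 0 < B i ∧ Above A (B - Finsupp.single i 1) := by
  simp only [Above, add_single_apply, sub_single_apply] at *
  push Not at h
  obtain ⟨j, hj⟩ := h
  have hA' := fun k => hA (Nat.le_succ k)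
  have hB' := fun k => hB (Nat.le_succ k)
  constructor
  · intro H
    have h1 := H j
    have h2 : j = i := by grind
    subst h2
    refine ⟨by grind, fun k => ?_⟩
    have := H k
    have := hA' k
    grind
  · rintro ⟨h0, H⟩ k
    have h1 := H j
    have h2 : j = i := by grind
    subst h2
    have := H k
    have := H (k + 1)
    have := hB' k
    have := hA' k
    grind

lemma above_add_single_right_iff {A B : ℕ →₀ ℕ} (h : Above B A) (i : ℕ) :
    Above B (A + Finsupp.single i 1) ↔ 0 < B i ∧ Above (B - Finsupp.single i 1) A := by
  simp only [Above, add_single_apply, sub_single_apply] at *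
  constructor
  · intro H
    have h1 := H i
    refine ⟨by grind, fun k => ?_⟩
    have := h k
    have := H k
    grind
  · rintro ⟨h0, H⟩ k
    have := h k
    have := H k
    grind

lemma not_above_sub_single_zero {A B : ℕ →₀ ℕ} (h : ¬ Above B A) :
    ¬ Above (B - Finsupp.single 0 1) A := by
  contrapose! h
  intro k
  have := h k
  simp only [sub_single_apply] at this
  grind

lemma above_add_single_right_iff_of_not {A B : ℕ →₀ ℕ} (hA : Antitone A) (hB : Antitone B)
    (h : ¬ Above B A) (i : ℕ) :
    Above B (A + Finsupp.single i 1) ↔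
      0 < B (i + 1) ∧ Above (B - Finsupp.single (i + 1) 1) A := by
  simp only [Above, add_single_apply, sub_single_apply] at *
  push Not at h
  obtain ⟨j, hj⟩ := h
  have hA' := fun k => hA (Nat.le_succ k)
  have hB' := fun k => hB (Nat.le_succ k)
  constructor
  · intro H
    have h1 := H j
    have h2 : j = i := by grind
    subst h2
    refine ⟨by grind, fun k => ?_⟩
    have := H k
    have := hB' k
    have := hB' (k + 1)
    have := hA' k
    grind
  · rintro ⟨h0, H⟩ k
    have h1 := H j
    have h2 : j = i := by grind
    subst h2
    have := H k
    have := hA' k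
    have := hB' k
    grind

/-- The interlacing condition at step `t`: downwards if `t ∈ S`, upwards otherwise. -/
def Step (S : Set ℤ) (t : ℤ) (A B : ℕ →₀ ℕ) : Prop :=
  if t ∈ S then Above A B else Above B A

lemma Step.antitone_left {S : Set ℤ} {t : ℤ} {A B : ℕ →₀ ℕ} (h : Step S t A B) : Antitone A := by
  unfold Step at h
  split_ifs at h
  exacts [h.antitone_left, h.antitone_right]

lemma Step.antitone_right {S : Set ℤ} {t : ℤ} {A B : ℕ →₀ ℕ} (h : Step S t A B) : Antitone B := by
  unfold Step at h
  split_ifs at h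
  exacts [h.antitone_right, h.antitone_left]

/-- The total size of the partitions `x s` with `lo ≤ s ≤ hi`. -/
def weight (lo hi : ℤ) (x : ℤ → ℕ →₀ ℕ) : ℤ := ∑ s ∈ Finset.Icc lo hi, ((x s).degree : ℤ)

lemma weight_update {lo hi t : ℤ} (hlo : lo ≤ t) (hhi : t ≤ hi) (x : ℤ → ℕ →₀ ℕ) (C : ℕ →₀ ℕ) :
    weight lo hi (Function.update x t C) = weight lo hi x + C.degree - (x t).degree := by
  have ht : t ∈ Finset.Icc lo hi := Finset.mem_Icc.2 ⟨hlo, hhi⟩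
  unfold weight
  rw [← Finset.add_sum_erase _ _ ht, ← Finset.add_sum_erase _ _ ht]
  rw [Finset.sum_congr rfl (g := fun s => ((x s).degree : ℤ))]
  · simp
    ring
  · intro s hs
    rw [Function.update_of_ne (Finset.ne_of_mem_erase hs)]

lemma weight_congr {lo hi : ℤ} {x y : ℤ → ℕ →₀ ℕ} (h : ∀ s, lo ≤ s → s ≤ hi → x s = y s) :
    weight lo hi x = weight lo hi y :=
  Finset.sum_congr rfl fun s hs => by
    rw [h s (Finset.mem_Icc.1 hs).1 (Finset.mem_Icc.1 hs).2]

/-- Interlacing chains of total size `m` that equal `A` up to `lo` and `B` from `hi` on. -/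
def chains (S : Set ℤ) (lo hi : ℤ) (A B : ℕ →₀ ℕ) (m : ℤ) : Set (ℤ → ℕ →₀ ℕ) :=
  {x | (∀ s ≤ lo, x s = A) ∧ (∀ s, hi ≤ s → x s = B) ∧
    (∀ s, lo ≤ s → s < hi → Step S s (x s) (x (s + 1))) ∧ weight lo hi x = m}

/-- Chains from `∅` to `B` that become interlacing at step `t` after adding a box to the partition
before the step. -/
def addChains (S : Set ℤ) (lo hi : ℤ) (B : ℕ →₀ ℕ) (t m : ℤ) : Set ((ℤ → ℕ →₀ ℕ) × ℕ) :=
  {q | (∀ s ≤ lo, q.1 s = 0) ∧ (∀ s, hi ≤ s → q.1 s = B) ∧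
    (∀ s, lo ≤ s → s < hi → s ≠ t → Step S s (q.1 s) (q.1 (s + 1))) ∧ weight lo hi q.1 = m ∧
    Step S t (q.1 t + Finsupp.single q.2 1) (q.1 (t + 1))}

/-- Chains from `∅` to `B` that become interlacing at step `t` after removing a box from the
partition after the step. -/
def subChains (S : Set ℤ) (lo hi : ℤ) (B : ℕ →₀ ℕ) (t m : ℤ) : Set ((ℤ → ℕ →₀ ℕ) × ℕ) :=
  {q | (∀ s ≤ lo, q.1 s = 0) ∧ (∀ s, hi ≤ s → q.1 s = B) ∧
    (∀ s, lo ≤ s → s < hi → s ≠ t → Step S s (q.1 s) (q.1 (s + 1))) ∧ weight lo hi q.1 = m ∧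
    0 < q.1 (t + 1) q.2 ∧ Step S t (q.1 t) (q.1 (t + 1) - Finsupp.single q.2 1)}

lemma encard_eq_of_inverse {α β : Type*} {s : Set α} {t : Set β} (f : α → β) (g : β → α)
    (hf : ∀ a ∈ s, f a ∈ t ∧ g (f a) = a) (hg : ∀ b ∈ t, g b ∈ s ∧ f (g b) = b) :
    s.encard = t.encard := by
  have h : Set.InjOn f s := fun a ha b hb hab => by rw [← (hf a ha).2, hab, (hf b hb).2]
  rw [← h.encard_image]
  congr 1
  ext b
  constructor
  · rintro ⟨a, ha, rfl⟩
    exact (hf a ha).1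
  · exact fun hb => ⟨g b, (hg b hb).1, (hg b hb).2⟩

lemma antitone_before {S : Set ℤ} {lo hi t : ℤ} {x : ℤ → ℕ →₀ ℕ} (h0 : ∀ s ≤ lo, x s = 0)
    (hs : ∀ s, lo ≤ s → s < hi → s ≠ t → Step S s (x s) (x (s + 1))) (ht : lo ≤ t) (ht' : t < hi) :
    Antitone (x t) := by
  rcases ht.eq_or_lt with rfl | h
  · rw [h0 _ le_rfl]
    exact fun _ _ _ => le_rfl
  · simpa using (hs (t - 1) (by omega) (by omega) (by omega)).antitone_right

lemma antitone_after {S : Set ℤ} {lo hi t : ℤ} {x : ℤ → ℕ →₀ ℕ} {B : ℕ →₀ ℕ} (hB : Antitone B)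
    (h1 : ∀ s, hi ≤ s → x s = B)
    (hs : ∀ s, lo ≤ s → s < hi → s ≠ t → Step S s (x s) (x (s + 1))) (ht : lo ≤ t) :
    Antitone (x (t + 1)) := by
  rcases le_or_gt hi (t + 1) with h | h
  · rwa [h1 _ h]
  · exact (hs (t + 1) (by omega) h (by omega)).antitone_left

lemma encard_addChains {S : Set ℤ} {lo hi t : ℤ} {B : ℕ →₀ ℕ} (hB : Antitone B) (ht : lo ≤ t)
    (ht' : t < hi) (m : ℤ) :
    (addChains S lo hi B t m).encard =
      (if t ∈ S then (chains S lo hi 0 B m).encard else 0) +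
        (subChains S lo hi B t m).encard := by
  by_cases hS : t ∈ S
  · rw [if_pos hS]
    set φ : (ℤ → ℕ →₀ ℕ) × ℕ → (ℤ → ℕ →₀ ℕ) × ℕ := fun q =>
      (q.1, if Above (q.1 t) (q.1 (t + 1)) then q.2 + 1 else q.2) with hφ
    have hinj : Function.Injective φ := by
      rintro ⟨x, i⟩ ⟨y, j⟩ h
      simp only [hφ, Prod.mk.injEq] at h
      obtain ⟨rfl, h⟩ := h
      grind
    have hinj' : Function.Injective fun x : ℤ → ℕ →₀ ℕ => (x, 0) := fun x y h => by simpa using h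
    rw [← hinj.encard_image (subChains S lo hi B t m),
      ← hinj'.encard_image (chains S lo hi 0 B m), ← Set.encard_union_eq]
    · congr 1
      ext ⟨x, i⟩
      simp only [addChains, chains, subChains, Set.mem_union, Set.mem_image, Set.mem_ofPred_eq,
        Prod.mk.injEq, Prod.exists, hφ, Step, if_pos hS]
      constructor
      · rintro ⟨h0, h1, hs, hw, h⟩
        by_cases hab : Above (x t) (x (t + 1))
        · rcases i with - | i
          · refine Or.inl ⟨x, ⟨h0, h1, fun s hs1 hs2 => ?_, hw⟩, rfl, rfl⟩
            by_cases hst : s = t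
            · subst hst
              simpa [hS] using hab
            · exact hs s hs1 hs2 hst
          · exact Or.inr ⟨x, i, ⟨h0, h1, hs, hw, (above_add_single_succ_iff hab i).1 h⟩, rfl,
              by simp [hab]⟩
        · have hA := antitone_before h0 hs ht ht'
          have hB' := antitone_after hB h1 hs ht
          exact Or.inr ⟨x, i, ⟨h0, h1, hs, hw, (above_add_single_iff_of_not hA hB' hab i).1 h⟩, rfl,
            by simp [hab]⟩
      · rintro (⟨x, ⟨h0, h1, hs, hw⟩, rfl, rfl⟩ | ⟨x, j, ⟨h0, h1, hs, hw, h⟩, rfl, rfl⟩)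
        · have := hs t ht ht'
          rw [if_pos hS] at this
          exact ⟨h0, h1, fun s a b _ => hs s a b, hw, above_add_single_zero this⟩
        · refine ⟨h0, h1, hs, hw, ?_⟩
          by_cases hab : Above (x t) (x (t + 1))
          · simpa [hab] using (above_add_single_succ_iff hab j).2 h
          · have hA := antitone_before h0 hs ht ht'
            have hB' := antitone_after hB h1 hs ht
            simpa [hab] using (above_add_single_iff_of_not hA hB' hab j).2 h
    · rw [Set.disjoint_left]
      rintro - ⟨x, ⟨-, -, hs, -⟩, rfl⟩ ⟨⟨y, j⟩, -, h⟩
      have := hs t ht ht'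
      simp only [Step, if_pos hS] at this
      simp only [hφ, Prod.mk.injEq] at h
      obtain ⟨rfl, h⟩ := h
      simp [this] at h
  · rw [if_neg hS, zero_add]
    refine encard_eq_of_inverse
      (fun q => (q.1, if Above (q.1 (t + 1)) (q.1 t) then q.2 else q.2 + 1))
      (fun q => (q.1, if Above (q.1 (t + 1)) (q.1 t) then q.2 else q.2 - 1)) ?_ ?_
    · rintro ⟨x, i⟩ ⟨h0, h1, hs, hw, h⟩
      simp only [Step, if_neg hS] at h
      by_cases hab : Above (x (t + 1)) (x t)
      · simp only [if_pos hab]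
        refine ⟨⟨h0, h1, hs, hw, ?_⟩, by simp⟩
        simpa only [Step, if_neg hS] using (above_add_single_right_iff hab i).1 h
      · simp only [if_neg hab]
        refine ⟨⟨h0, h1, hs, hw, ?_⟩, by simp⟩
        have hA := antitone_before h0 hs ht ht'
        have hB' := antitone_after hB h1 hs ht
        simpa only [Step, if_neg hS] using (above_add_single_right_iff_of_not hA hB' hab i).1 h
    · rintro ⟨x, i⟩ ⟨h0, h1, hs, hw, h⟩
      simp only [Step, if_neg hS] at h
      by_cases hab : Above (x (t + 1)) (x t)
      · simp only [if_pos hab]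
        refine ⟨⟨h0, h1, hs, hw, ?_⟩, by simp⟩
        simpa only [Step, if_neg hS] using (above_add_single_right_iff hab i).2 h
      · simp only [if_neg hab]
        rcases i with - | i
        · exact absurd h.2 (not_above_sub_single_zero hab)
        refine ⟨⟨h0, h1, hs, hw, ?_⟩, by simp⟩
        have hA := antitone_before h0 hs ht ht'
        have hB' := antitone_after hB h1 hs ht
        simpa [Step, if_neg hS] using (above_add_single_right_iff_of_not hA hB' hab i).2 h

lemma sub_single_add_single {A : ℕ →₀ ℕ} {i : ℕ} (h : 0 < A i) :
    A - Finsupp.single i 1 + Finsupp.single i 1 = A := by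
  ext k
  rw [add_single_apply, sub_single_apply]
  grind

lemma encard_subChains {S : Set ℤ} {lo hi t : ℤ} {B : ℕ →₀ ℕ} (ht : lo ≤ t)
    (ht' : t + 1 < hi) (m : ℤ) :
    (subChains S lo hi B t m).encard = (addChains S lo hi B (t + 1) (m - 1)).encard := by
  refine encard_eq_of_inverse
    (fun q => (Function.update q.1 (t + 1) (q.1 (t + 1) - Finsupp.single q.2 1), q.2))
    (fun q => (Function.update q.1 (t + 1) (q.1 (t + 1) + Finsupp.single q.2 1), q.2)) ?_ ?_
  · rintro ⟨x, i⟩ ⟨h0, h1, hs, hw, hpos, h⟩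
    dsimp only at *
    have hC := sub_single_add_single hpos
    refine ⟨⟨fun s hs' => ?_, fun s hs' => ?_, fun s hs1 hs2 hne => ?_, ?_, ?_⟩, ?_⟩
    · dsimp only
      rw [Function.update_of_ne (by omega), h0 s hs']
    · dsimp only
      rw [Function.update_of_ne (by omega), h1 s hs']
    · dsimp only
      rw [Function.update_of_ne hne]
      by_cases hst : s = t
      · subst hst
        rwa [Function.update_self]
      · rw [Function.update_of_ne (by omega)]
        exact hs s hs1 hs2 hst
    · dsimp only
      rw [weight_update (by omega) (by omega), hw]
      have := congrArg Finsupp.degree hC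
      rw [map_add, Finsupp.degree_single] at this
      omega
    · dsimp only
      rw [Function.update_self, hC, Function.update_of_ne (by omega)]
      exact hs (t + 1) (by omega) ht' (by omega)
    · simp [hC]
  · rintro ⟨x, i⟩ ⟨h0, h1, hs, hw, h⟩
    dsimp only at *
    refine ⟨⟨fun s hs' => ?_, fun s hs' => ?_, fun s hs1 hs2 hne => ?_, ?_, ?_, ?_⟩, ?_⟩
    · dsimp only
      rw [Function.update_of_ne (by omega), h0 s hs']
    · dsimp only
      rw [Function.update_of_ne (by omega), h1 s hs']
    · dsimp only
      rw [Function.update_of_ne (a := s + 1) (by omega)]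
      by_cases hst : s = t + 1
      · subst hst
        rwa [Function.update_self]
      · rw [Function.update_of_ne hst]
        exact hs s hs1 hs2 hst
    · dsimp only
      rw [weight_update (by omega) (by omega), hw]
      simp
    · simp
    · dsimp only
      rw [Function.update_self, Function.update_of_ne (by omega), add_tsub_cancel_right]
      exact hs t ht (by omega) (by omega)
    · simp

lemma encard_addChains_eq_sum {S : Set ℤ} {lo hi : ℤ} {B : ℕ →₀ ℕ} (hB : Antitone B) (m : ℤ)
    (k : ℕ) (hk : lo + k < hi) :
    (addChains S lo hi B lo m).encard =
      ∑ j ∈ Finset.range (k + 1),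
        (if lo + j ∈ S then (chains S lo hi 0 B (m - j)).encard else 0) +
      (subChains S lo hi B (lo + k) (m - k)).encard := by
  induction k with
  | zero => simpa using encard_addChains hB le_rfl (by simpa using hk) m
  | succ k ih =>
    rw [ih (by push_cast at hk; omega), encard_subChains (by omega) (by push_cast at hk; omega),
      encard_addChains hB (by omega) (by push_cast at hk; omega), Finset.sum_range_succ _ (k + 1),
      add_assoc (Finset.sum _ _)]
    push_cast
    simp only [add_assoc, sub_sub]

lemma antitone_single {i c : ℕ} (hc : c ≠ 0) (h : Antitone (Finsupp.single i c : ℕ →₀ ℕ)) :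
    i = 0 := by
  by_contra hi
  have := h (Nat.zero_le i)
  rw [Finsupp.single_eq_same, Finsupp.single_eq_of_ne (Ne.symm hi)] at this
  omega

lemma encard_chains_single {S : Set ℤ} {lo hi : ℤ} (B : ℕ →₀ ℕ) (h : lo < hi) (m : ℤ) :
    (chains S lo hi (Finsupp.single 0 1) B m).encard = (addChains S lo hi B lo (m - 1)).encard := by
  refine encard_eq_of_inverse (fun x => (fun s => if s ≤ lo then 0 else x s, 0))
    (fun q s => if s ≤ lo then Finsupp.single 0 1 else q.1 s) ?_ ?_
  · rintro x ⟨h0, h1, hs, hw⟩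
    refine ⟨⟨fun s hs' => if_pos hs', fun s hs' => ?_, fun s hs1 hs2 hne => ?_, ?_, ?_⟩, ?_⟩
    · dsimp only
      rw [if_neg (by omega), h1 s hs']
    · dsimp only
      rw [if_neg (by omega), if_neg (by omega)]
      exact hs s hs1 hs2
    · dsimp only
      rw [weight_congr (y := Function.update x lo 0), weight_update le_rfl h.le, hw, h0 lo le_rfl]
      · simp
      · intro s hs1 hs2
        rcases hs1.eq_or_lt with rfl | hs1
        · simp
        · rw [if_neg (by omega), Function.update_of_ne (by omega)]
    · dsimp only
      rw [if_pos le_rfl, if_neg (by omega), zero_add, ← h0 lo le_rfl]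
      exact hs lo le_rfl h
    · funext s
      dsimp only
      split_ifs with hs'
      · exact (h0 s hs').symm
      · rfl
  · rintro ⟨x, i⟩ ⟨h0, h1, hs, hw, hstep⟩
    dsimp only at *
    rw [h0 lo le_rfl, zero_add] at hstep
    obtain rfl := antitone_single one_ne_zero hstep.antitone_left
    refine ⟨⟨fun s hs' => if_pos hs', fun s hs' => ?_, fun s hs1 hs2 => ?_, ?_⟩, ?_⟩
    · dsimp only
      rw [if_neg (by omega), h1 s hs']
    · dsimp only
      rcases hs1.eq_or_lt with rfl | hs1
      · rwa [if_pos le_rfl, if_neg (by omega)]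
      · rw [if_neg (by omega), if_neg (by omega)]
        exact hs s hs1.le hs2 hs1.ne'
    · rw [weight_congr (y := Function.update x lo (Finsupp.single 0 1)),
        weight_update le_rfl h.le, hw, h0 lo le_rfl]
      · simp
      · intro s hs1 hs2
        rcases hs1.eq_or_lt with rfl | hs1
        · simp
        · rw [if_neg (by omega), Function.update_of_ne (by omega)]
    · simp only [Prod.mk.injEq, and_true]
      funext s
      split_ifs with hs'
      · exact (h0 s hs').symm
      · rfl

lemma encard_subChains_zero {S : Set ℤ} {lo hi : ℤ} (m : ℤ) :
    (subChains S lo hi 0 (hi - 1) m).encard = 0 := by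
  rw [Set.encard_eq_zero, Set.eq_empty_iff_forall_notMem]
  rintro ⟨x, i⟩ ⟨-, h1, -, -, hpos, -⟩
  dsimp only at h1 hpos
  simp [h1 hi le_rfl] at hpos

lemma encard_subChains_single {S : Set ℤ} {lo hi : ℤ} (h : lo < hi) (m : ℤ) :
    (subChains S lo hi (Finsupp.single 0 1) (hi - 1) m).encard =
      (chains S lo hi 0 0 (m - 1)).encard := by
  refine encard_eq_of_inverse (fun q s => if hi ≤ s then 0 else q.1 s)
    (fun x => (fun s => if hi ≤ s then Finsupp.single 0 1 else x s, 0)) ?_ ?_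
  · rintro ⟨x, i⟩ ⟨h0, h1, hs, hw, hpos, hstep⟩
    dsimp only at *
    rw [sub_add_cancel, h1 hi le_rfl] at hpos hstep
    have hi0 : i = 0 := by
      by_contra hne
      rw [Finsupp.single_eq_of_ne hne] at hpos
      omega
    subst hi0
    rw [tsub_self] at hstep
    refine ⟨⟨fun s hs' => ?_, fun s hs' => if_pos hs', fun s hs1 hs2 => ?_, ?_⟩, ?_⟩
    · dsimp only
      rw [if_neg (by omega), h0 s hs']
    · dsimp only
      rw [if_neg (by omega)]
      by_cases hs' : s = hi - 1
      · subst hs'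
        rwa [if_pos (by omega)]
      · rw [if_neg (by omega)]
        exact hs s hs1 hs2 hs'
    · rw [weight_congr (y := Function.update x hi 0), weight_update h.le le_rfl, hw, h1 hi le_rfl]
      · simp
      · intro s hs1 hs2
        rcases hs2.eq_or_lt with rfl | hs2
        · simp
        · rw [if_neg (by omega), Function.update_of_ne (by omega)]
    · simp only [Prod.mk.injEq, and_true]
      funext s
      split_ifs with hs'
      · exact (h1 s hs').symm
      · rfl
  · rintro x ⟨h0, h1, hs, hw⟩
    refine ⟨⟨fun s hs' => ?_, fun s hs' => if_pos hs', fun s hs1 hs2 hne => ?_, ?_, ?_, ?_⟩, ?_⟩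
    · dsimp only
      rw [if_neg (by omega), h0 s hs']
    · dsimp only
      rw [if_neg (by omega), if_neg (by omega)]
      exact hs s hs1 hs2
    · dsimp only
      rw [weight_congr (y := Function.update x hi (Finsupp.single 0 1)),
        weight_update h.le le_rfl, hw, h1 hi le_rfl]
      · simp
      · intro s hs1 hs2
        rcases hs2.eq_or_lt with rfl | hs2
        · simp
        · rw [if_neg (by omega), Function.update_of_ne (by omega)]
    · simp
    · dsimp only
      have := hs (hi - 1) (by omega) (by omega)
      rw [sub_add_cancel, h1 hi le_rfl] at this
      rwa [if_neg (by omega), if_pos (by omega), tsub_self]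
    · funext s
      dsimp only
      split_ifs with hs'
      · exact (h1 s hs').symm
      · rfl

/-- The partition (1) if `b`, and the empty partition otherwise. -/
def endPart (b : Bool) : ℕ →₀ ℕ := if b then Finsupp.single 0 1 else 0

lemma antitone_endPart (b : Bool) : Antitone (endPart b) := by
  intro i j h
  cases b
  · simp [endPart]
  · simp only [endPart, if_true, Finsupp.single_apply]
    grind

lemma degree_endPart (b : Bool) : (endPart b).degree = b.toNat := by
  cases b <;> simp [endPart]

/-- Removing the box at the lower end of a window. -/
lemma encard_chains_true {S : Set ℤ} {lo : ℤ} {L : ℕ} (hL : L ≠ 0) (b : Bool) (m : ℤ) :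
    (chains S lo (lo + L) (endPart true) (endPart b) m).encard =
      ∑ j ∈ Finset.range L, (if lo + j ∈ S then
        (chains S lo (lo + L) (endPart false) (endPart b) (m - 1 - j)).encard else 0) +
      if b then (chains S lo (lo + L) (endPart false) (endPart false) (m - 1 - L)).encard
        else 0 := by
  obtain ⟨k, rfl⟩ := Nat.exists_eq_succ_of_ne_zero hL
  have hk : lo < lo + ((k + 1 : ℕ) : ℤ) := by push_cast; omega
  have hk' : lo + (k : ℤ) = lo + ((k + 1 : ℕ) : ℤ) - 1 := by push_cast; omega
  have := encard_addChains_eq_sum (S := S) (lo := lo) (hi := lo + (k + 1 : ℕ))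
    (antitone_endPart b) (m - 1) k (by push_cast; omega)
  rw [hk'] at this
  rw [Nat.succ_eq_add_one, show endPart true = Finsupp.single 0 1 from rfl,
    encard_chains_single _ hk, this]
  congr 1
  cases b
  · exact encard_subChains_zero _
  · rw [show endPart true = Finsupp.single 0 1 from rfl, encard_subChains_single hk]
    simp only [if_true]
    congr 2
    push_cast
    ring

/-- The shifted index `j - λ_j` of the `j`-th row. -/
def rowShift (μ : YoungDiagram) (j : ℕ) : ℤ := j - μ.rowLen j

/-- The downward steps of the boundary path of `μ`. -/
def downSteps (μ : YoungDiagram) : Set ℤ := Set.range (rowShift μ)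

lemma strictMono_rowShift (μ : YoungDiagram) : StrictMono (rowShift μ) := fun i j h => by
  have := μ.rowLen_anti i j h.le
  unfold rowShift
  omega

lemma exists_le_rowShift (μ : YoungDiagram) (t : ℤ) : ∃ j, t ≤ rowShift μ j := by
  refine ⟨(t + μ.rowLen 0).toNat, ?_⟩
  have := μ.rowLen_anti 0 (t + μ.rowLen 0).toNat (Nat.zero_le _)
  unfold rowShift
  omega

/-- The row of the first cell outside `μ` on the diagonal `j - k = t`. -/
def diagRow (μ : YoungDiagram) (t : ℤ) : ℕ := Nat.find (exists_le_rowShift μ t)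

lemma diagRow_le_iff {μ : YoungDiagram} {t : ℤ} {j : ℕ} : diagRow μ t ≤ j ↔ t ≤ rowShift μ j := by
  constructor
  · exact fun h =>
      (Nat.find_spec (exists_le_rowShift μ t)).trans ((strictMono_rowShift μ).monotone h)
  · exact fun h => Nat.find_min' _ h

lemma notMem_iff_diagRow_le {μ : YoungDiagram} {j k : ℕ} :
    (j, k) ∉ μ ↔ diagRow μ ((j : ℤ) - k) ≤ j := by
  rw [diagRow_le_iff, YoungDiagram.mem_iff_lt_rowLen, rowShift]
  omega

lemma le_diagRow (μ : YoungDiagram) (t : ℤ) : t ≤ diagRow μ t := by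
  have : t ≤ rowShift μ (diagRow μ t) := diagRow_le_iff.1 le_rfl
  unfold rowShift at this
  omega

lemma diagRow_add_one_of_mem {μ : YoungDiagram} {t : ℤ} (h : t ∈ downSteps μ) :
    diagRow μ (t + 1) = diagRow μ t + 1 := by
  obtain ⟨j, rfl⟩ := h
  refine eq_of_forall_ge_iff fun c => ?_
  have : diagRow μ (rowShift μ j) = j := eq_of_forall_ge_iff fun c => by
    rw [diagRow_le_iff, (strictMono_rowShift μ).le_iff_le]
  rw [this, diagRow_le_iff, Int.add_one_le_iff, (strictMono_rowShift μ).lt_iff_lt,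
    Nat.add_one_le_iff]

lemma diagRow_add_one_of_notMem {μ : YoungDiagram} {t : ℤ} (h : t ∉ downSteps μ) :
    diagRow μ (t + 1) = diagRow μ t := by
  refine eq_of_forall_ge_iff fun c => ?_
  rw [diagRow_le_iff, diagRow_le_iff, Int.add_one_le_iff]
  exact ⟨le_of_lt, fun h' => h'.lt_of_ne fun h'' => h ⟨c, h''.symm⟩⟩

/-- A bound for the rows and columns of `μ`. -/
def bound (μ : YoungDiagram) : ℕ := μ.colLen 0 + μ.rowLen 0 + 1

lemma lt_bound_of_mem {μ : YoungDiagram} {j k : ℕ} (h : (j, k) ∈ μ) :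
    j < bound μ ∧ k < bound μ := by
  have h1 := YoungDiagram.mem_iff_lt_colLen.1 (μ.up_left_mem le_rfl (Nat.zero_le k) h)
  have h2 := YoungDiagram.mem_iff_lt_rowLen.1 (μ.up_left_mem (Nat.zero_le j) le_rfl h)
  unfold bound
  omega

lemma rowLen_eq_zero {μ : YoungDiagram} {j : ℕ} (h : bound μ ≤ j) : μ.rowLen j = 0 := by
  by_contra hne
  have := (lt_bound_of_mem (YoungDiagram.mem_iff_lt_rowLen.2 (Nat.pos_of_ne_zero hne))).1
  omega

lemma rowShift_eq {μ : YoungDiagram} {j : ℕ} (h : bound μ ≤ j) : rowShift μ j = j := by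
  simp [rowShift, rowLen_eq_zero h]

lemma neg_bound_lt_rowShift (μ : YoungDiagram) (j : ℕ) : -(bound μ : ℤ) < rowShift μ j := by
  have := μ.rowLen_anti 0 j (Nat.zero_le _)
  unfold rowShift bound
  omega

lemma mem_downSteps {μ : YoungDiagram} {t : ℤ} (h : (bound μ : ℤ) ≤ t) : t ∈ downSteps μ :=
  ⟨t.toNat, by rw [rowShift_eq (by omega)]; omega⟩

lemma notMem_downSteps {μ : YoungDiagram} {t : ℤ} (h : t < -(bound μ : ℤ)) : t ∉ downSteps μ := by
  rintro ⟨j, rfl⟩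
  have := neg_bound_lt_rowShift μ j
  omega

lemma diagRow_of_bound_le {μ : YoungDiagram} {t : ℤ} (h : (bound μ : ℤ) ≤ t) :
    (diagRow μ t : ℤ) = t := by
  refine le_antisymm ?_ (le_diagRow μ t)
  have : diagRow μ t ≤ t.toNat := diagRow_le_iff.2 (by rw [rowShift_eq (by omega)]; omega)
  omega

lemma diagRow_of_le_neg_bound {μ : YoungDiagram} {t : ℤ} (h : t ≤ -(bound μ : ℤ)) :
    diagRow μ t = 0 :=
  Nat.le_zero.1 (diagRow_le_iff.2 (h.trans (neg_bound_lt_rowShift μ 0).le))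

/-- The chains encoding the 3D partitions of renormalized volume `n` that are asymptotic to
`(μ, m, n)`, where `m` and `n` have at most one box. -/
def vchains (μ : YoungDiagram) (N : ℕ) (a b : Bool) (n : ℤ) : Set (ℤ → ℕ →₀ ℕ) :=
  chains (downSteps μ) (-N) N (endPart a) (endPart b) (n + (a.toNat + b.toNat) * (N + 1))

lemma above_self {A : ℕ →₀ ℕ} (h : Antitone A) : Above A A := fun i => ⟨le_rfl, h (Nat.le_succ i)⟩

lemma above_of_mem_chains {μ : YoungDiagram} {N : ℕ} {a b : Bool} {m : ℤ} {x : ℤ → ℕ →₀ ℕ}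
    (hx : x ∈ chains (downSteps μ) (-N) N (endPart a) (endPart b) m) (hN : bound μ ≤ N) (t : ℤ) :
    Step (downSteps μ) t (x t) (x (t + 1)) := by
  obtain ⟨h0, h1, hs, -⟩ := hx
  rcases le_or_gt (N : ℤ) t with h | h
  · rw [h1 t h, h1 (t + 1) (by omega), Step, if_pos (mem_downSteps (by omega))]
    exact above_self (antitone_endPart b)
  rcases le_or_gt (-(N : ℤ)) t with h' | h'
  · exact hs t h' h
  · rw [h0 t h'.le, h0 (t + 1) (by omega), Step, if_neg (notMem_downSteps (by omega))]
    exact above_self (antitone_endPart a)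

lemma le_right {μ : YoungDiagram} {x : ℤ → ℕ →₀ ℕ}
    (hx : ∀ t, Step (downSteps μ) t (x t) (x (t + 1))) {s : ℤ} (hs : (bound μ : ℤ) ≤ s) (d : ℕ) :
    x (s + d) ≤ x s := by
  induction d with
  | zero => simp
  | succ d ih =>
    have h := hx (s + d)
    rw [Step, if_pos (mem_downSteps (by omega))] at h
    push_cast
    rw [← add_assoc]
    exact le_trans (fun i => (h i).1) ih

lemma le_left {μ : YoungDiagram} {x : ℤ → ℕ →₀ ℕ}
    (hx : ∀ t, Step (downSteps μ) t (x t) (x (t + 1))) {s : ℤ} (hs : s ≤ -(bound μ : ℤ)) (d : ℕ) :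
    x (s - d) ≤ x s := by
  induction d with
  | zero => simp
  | succ d ih =>
    have h := hx (s - d - 1)
    rw [Step, if_neg (notMem_downSteps (by omega)), sub_add_cancel] at h
    push_cast
    rw [← sub_sub]
    exact le_trans (fun i => (h i).1) ih

lemma degree_le_of_le {A B : ℕ →₀ ℕ} (h : A ≤ B) : A.degree ≤ B.degree := by
  obtain ⟨C, rfl⟩ := exists_add_of_le h
  rw [map_add]
  omega

lemma degree_lt_of_le {A B : ℕ →₀ ℕ} (h : A ≤ B) (hne : B ≠ A) : A.degree < B.degree := by
  obtain ⟨C, rfl⟩ := exists_add_of_le h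
  rw [map_add]
  have : C.degree ≠ 0 := fun hC => hne (by rw [(Finsupp.degree_eq_zero_iff C).1 hC, add_zero])
  omega

lemma le_weight {μ : YoungDiagram} {N : ℕ} {x : ℤ → ℕ →₀ ℕ}
    (hx : ∀ t, Step (downSteps μ) t (x t) (x (t + 1))) {e : ℕ} (he : bound μ + e = N) :
    (e + 1 : ℤ) * ((x N).degree + (x (-N)).degree) ≤ weight (-N) N x := by
  have hb : 0 < bound μ := by unfold bound; omega
  have h1 : ∑ s ∈ Finset.Icc (bound μ : ℤ) N, ((x N).degree : ℤ) ≤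
      ∑ s ∈ Finset.Icc (bound μ : ℤ) N, ((x s).degree : ℤ) := by
    refine Finset.sum_le_sum fun s hs => ?_
    rw [Finset.mem_Icc] at hs
    have := le_right hx hs.1 (N - s).toNat
    rw [show s + ((N - s).toNat : ℤ) = N by omega] at this
    exact_mod_cast degree_le_of_le this
  have h2 : ∑ s ∈ Finset.Icc (-N : ℤ) (-bound μ), ((x (-N)).degree : ℤ) ≤
      ∑ s ∈ Finset.Icc (-N : ℤ) (-bound μ), ((x s).degree : ℤ) := by
    refine Finset.sum_le_sum fun s hs => ?_
    rw [Finset.mem_Icc] at hs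
    have := le_left hx hs.2 (s + N).toNat
    rw [show s - ((s + N).toNat : ℤ) = -N by omega] at this
    exact_mod_cast degree_le_of_le this
  have h3 : ∑ s ∈ Finset.Icc (bound μ : ℤ) N ∪ Finset.Icc (-N : ℤ) (-bound μ),
      ((x s).degree : ℤ) ≤ weight (-N) N x := by
    refine Finset.sum_le_sum_of_subset_of_nonneg ?_ fun _ _ _ => Int.natCast_nonneg _
    intro s hs
    simp only [Finset.mem_union, Finset.mem_Icc] at hs ⊢
    omega
  rw [Finset.sum_union] at h3
  · rw [Finset.sum_const, nsmul_eq_mul, Int.card_Icc] at h1 h2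
    rw [show ((N : ℤ) + 1 - bound μ).toNat = e + 1 by omega] at h1
    rw [show (-(bound μ : ℤ) + 1 - -N).toNat = e + 1 by omega] at h2
    push_cast at h1 h2
    linarith
  · rw [Finset.disjoint_left]
    intro s
    simp only [Finset.mem_Icc]
    omega

lemma weight_add_one (N : ℕ) (x : ℤ → ℕ →₀ ℕ) :
    weight (-(N + 1 : ℕ)) (N + 1 : ℕ) x =
      weight (-N) N x + (x (N + 1 : ℕ)).degree + (x (-(N + 1 : ℕ))).degree := by
  unfold weight
  have : Finset.Icc (-((N + 1 : ℕ) : ℤ)) ((N + 1 : ℕ) : ℤ) =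
      insert ((N + 1 : ℕ) : ℤ) (insert (-((N + 1 : ℕ) : ℤ)) (Finset.Icc (-(N : ℤ)) N)) := by
    ext s
    simp only [Finset.mem_insert, Finset.mem_Icc]
    omega
  rw [this, Finset.sum_insert, Finset.sum_insert]
  · ring
  · simp only [Finset.mem_Icc]
    omega
  · simp only [Finset.mem_insert, Finset.mem_Icc]
    omega

lemma vchains_subset_succ {μ : YoungDiagram} {N : ℕ} (hN : bound μ ≤ N) (a b : Bool) (n : ℤ) :
    vchains μ N a b n ⊆ vchains μ (N + 1) a b n := by
  intro x hx
  have hs := above_of_mem_chains hx hN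
  obtain ⟨h0, h1, -, hw⟩ := hx
  refine ⟨fun s hs' => h0 s (by omega), fun s hs' => h1 s (by omega), fun s _ _ => hs s, ?_⟩
  rw [weight_add_one, hw, h1 _ (by omega), h0 _ (by omega), degree_endPart, degree_endPart]
  push_cast
  ring

/-- A lower bound for the windows outside of which chains of renormalized volume `n` are
constant. -/
def window (μ : YoungDiagram) (n : ℤ) : ℕ := (n + 3 * bound μ + 3).toNat + bound μ

lemma le_of_mem_vchains {μ : YoungDiagram} {e : ℕ} {a b : Bool} {n : ℤ} {x : ℤ → ℕ →₀ ℕ}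
    (hx : x ∈ vchains μ (bound μ + e + 1) a b n) :
    (e + 1 : ℤ) * ((x (bound μ + e : ℕ)).degree + (x (-(bound μ + e : ℕ))).degree -
      (a.toNat + b.toNat)) ≤ n + (a.toNat + b.toNat) * bound μ := by
  have hs := above_of_mem_chains hx (by omega)
  obtain ⟨h0, h1, -, hw⟩ := hx
  have := le_weight hs (N := bound μ + e) rfl
  rw [weight_add_one, h0 _ le_rfl, h1 _ le_rfl, degree_endPart, degree_endPart] at hw
  push_cast at *
  linarith

lemma endPart_le_right {μ : YoungDiagram} {N : ℕ} {a b : Bool} {n : ℤ} {x : ℤ → ℕ →₀ ℕ}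
    (hx : x ∈ vchains μ N a b n) (hN : bound μ ≤ N) {s : ℤ} (hs : (bound μ : ℤ) ≤ s) :
    endPart b ≤ x s := by
  have := le_right (above_of_mem_chains hx hN) hs N
  rwa [hx.2.1 _ (by omega)] at this

lemma endPart_le_left {μ : YoungDiagram} {N : ℕ} {a b : Bool} {n : ℤ} {x : ℤ → ℕ →₀ ℕ}
    (hx : x ∈ vchains μ N a b n) (hN : bound μ ≤ N) {s : ℤ} (hs : s ≤ -(bound μ : ℤ)) :
    endPart a ≤ x s := by
  have := le_left (above_of_mem_chains hx hN) hs N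
  rwa [hx.1 _ (by omega)] at this

lemma toNat_le_one (b : Bool) : b.toNat ≤ 1 := by cases b <;> simp

lemma neg_le_of_mem_vchains {μ : YoungDiagram} {N : ℕ} (hN : bound μ ≤ N) {a b : Bool} {n : ℤ}
    {x : ℤ → ℕ →₀ ℕ} (hx : x ∈ vchains μ N a b n) : -(2 * bound μ : ℤ) ≤ n := by
  obtain ⟨e, rfl⟩ := Nat.exists_eq_add_of_le hN
  have hx' := vchains_subset_succ hN _ _ _ hx
  have h := le_of_mem_vchains hx'
  have h1 := degree_le_of_le (endPart_le_right hx hN (s := (bound μ + e : ℕ)) (by omega))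
  have h2 := degree_le_of_le (endPart_le_left hx hN (s := -(bound μ + e : ℕ)) (by omega))
  rw [degree_endPart] at h1 h2
  have h3 := toNat_le_one a
  have h4 := toNat_le_one b
  generalize (x (bound μ + e : ℕ)).degree = d₁ at *
  generalize (x (-(bound μ + e : ℕ))).degree = d₂ at *
  zify at h1 h2 h3 h4
  nlinarith

lemma vchains_succ_subset {μ : YoungDiagram} {N : ℕ} {n : ℤ} (hN : window μ n ≤ N) (a b : Bool) :
    vchains μ (N + 1) a b n ⊆ vchains μ N a b n := by
  intro x hx
  have hN' : bound μ ≤ N := le_trans (Nat.le_add_left _ _) hN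
  obtain ⟨e, rfl⟩ := Nat.exists_eq_add_of_le hN'
  have h := le_of_mem_vchains hx
  have h1 := endPart_le_right hx (by omega) (s := (bound μ + e : ℕ)) (by omega)
  have h2 := endPart_le_left hx (by omega) (s := -(bound μ + e : ℕ)) (by omega)
  have h1' := degree_le_of_le h1
  have h2' := degree_le_of_le h2
  have h3 := toNat_le_one a
  have h4 := toNat_le_one b
  have hlt : (x (bound μ + e : ℕ)).degree + (x (-(bound μ + e : ℕ))).degree <
      a.toNat + b.toNat + 1 := by
    by_contra hge
    rw [not_lt] at hge
    unfold window at hN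
    have hN : n + 3 * bound μ + 3 ≤ e := by omega
    generalize (x (bound μ + e : ℕ)).degree = d₁ at *
    generalize (x (-(bound μ + e : ℕ))).degree = d₂ at *
    zify at hge h3 h4
    nlinarith
  have e1 : x (bound μ + e : ℕ) = endPart b := by
    by_contra hne
    have := degree_lt_of_le h1 hne
    rw [degree_endPart] at *
    omega
  have e2 : x (-(bound μ + e : ℕ)) = endPart a := by
    by_contra hne
    have := degree_lt_of_le h2 hne
    rw [degree_endPart] at *
    omega
  obtain ⟨h0, h1, hs, hw⟩ := hx
  refine ⟨fun s hs' => ?_, fun s hs' => ?_, fun s hs1 hs2 => hs s (by omega) (by omega), ?_⟩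
  · rcases hs'.eq_or_lt with rfl | hs'
    · exact e2
    · exact h0 s (by omega)
  · rcases hs'.eq_or_lt with rfl | hs'
    · exact e1
    · exact h1 s (by omega)
  · rw [weight_add_one, h0 _ le_rfl, h1 _ le_rfl, degree_endPart, degree_endPart] at hw
    push_cast at *
    linarith

lemma vchains_subset {μ : YoungDiagram} {N N' : ℕ} {n : ℤ} (hN : window μ n ≤ N)
    (hN' : bound μ ≤ N') (a b : Bool) : vchains μ N' a b n ⊆ vchains μ N a b n := by
  have hb : bound μ ≤ N := le_trans (Nat.le_add_left _ _) hN
  rcases le_total N' N with h | h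
  · clear hN hb
    induction N, h using Nat.le_induction with
    | base => exact subset_rfl
    | succ N h ih => exact ih.trans (vchains_subset_succ (hN'.trans h) a b n)
  · clear hN'
    induction N', h using Nat.le_induction with
    | base => exact subset_rfl
    | succ N' h ih => exact (vchains_succ_subset (hN.trans h) a b).trans ih

lemma eq_zero_of_degree_le {A : ℕ →₀ ℕ} (hA : Antitone A) {d i : ℕ} (hd : A.degree ≤ d)
    (hi : d ≤ i) : A i = 0 := by
  by_contra hne
  have h : ∀ k ∈ Finset.range (i + 1), 1 ≤ A k := fun k hk =>
    (Nat.one_le_iff_ne_zero.2 hne).trans (hA (Nat.lt_succ_iff.1 (Finset.mem_range.1 hk)))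
  have hsub : Finset.range (i + 1) ⊆ A.support := fun k hk => by
    have := h k hk
    rw [Finsupp.mem_support_iff]
    omega
  have := Finset.card_nsmul_le_sum _ _ _ h
  have h' : (Finset.range (i + 1)).sum A ≤ A.degree :=
    Finset.sum_le_sum_of_subset_of_nonneg hsub fun _ _ _ => Nat.zero_le _
  simp only [Finset.card_range, smul_eq_mul, mul_one] at this
  omega

lemma finite_antitone_degree_le (d : ℕ) :
    {A : ℕ →₀ ℕ | Antitone A ∧ A.degree ≤ d}.Finite := by
  refine ((Finset.range d).finsupp fun _ => Finset.range (d + 1)).finite_toSet.subset ?_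
  rintro A ⟨hA, hd⟩
  rw [Finset.mem_coe, Finset.mem_finsupp_iff]
  constructor
  · intro i hi
    rw [Finset.mem_range]
    by_contra h
    exact Finsupp.mem_support_iff.1 hi (eq_zero_of_degree_le hA hd (not_lt.1 h))
  · intro i _
    rw [Finset.mem_range]
    have := Finsupp.le_degree i A
    omega

lemma degree_le_weight {lo hi s : ℤ} (h1 : lo ≤ s) (h2 : s ≤ hi) (x : ℤ → ℕ →₀ ℕ) :
    ((x s).degree : ℤ) ≤ weight lo hi x :=
  Finset.single_le_sum (f := fun s => ((x s).degree : ℤ)) (fun _ _ => Int.natCast_nonneg _)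
    (Finset.mem_Icc.2 ⟨h1, h2⟩)

lemma finite_vchains {μ : YoungDiagram} {N : ℕ} (hN : bound μ ≤ N) (a b : Bool) (n : ℤ) :
    (vchains μ N a b n).Finite := by
  set m : ℤ := n + (a.toNat + b.toNat) * (N + 1)
  refine Set.Finite.of_injOn (t := Set.pi Set.univ fun _ =>
      {A : ℕ →₀ ℕ | Antitone A ∧ A.degree ≤ m.toNat})
    (f := fun (x : ℤ → ℕ →₀ ℕ) (s : Set.Icc (-N : ℤ) N) => x s) ?_ ?_
    (Set.Finite.pi fun _ => finite_antitone_degree_le _)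
  · rintro x hx ⟨s, hs1, hs2⟩ -
    refine ⟨(above_of_mem_chains hx hN s).antitone_left, ?_⟩
    have := degree_le_weight hs1 hs2 x
    rw [hx.2.2.2] at this
    dsimp only
    omega
  · intro x hx y hy hxy
    funext s
    by_cases hs : s ∈ Set.Icc (-N : ℤ) N
    · exact congrFun hxy ⟨s, hs⟩
    · rw [Set.mem_Icc, not_and_or, not_le, not_le] at hs
      rcases hs with hs | hs
      · rw [hx.1 s hs.le, hy.1 s hs.le]
      · rw [hx.2.1 s hs.le, hy.2.1 s hs.le]

/-- The partition □ if `b`, and the empty partition otherwise. -/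
def endDiagram (b : Bool) : YoungDiagram := if b then box else ⊥

lemma mem_endDiagram {b : Bool} {i j : ℕ} : (i, j) ∈ endDiagram b ↔ b ∧ i = 0 ∧ j = 0 := by
  cases b
  · simp [endDiagram, YoungDiagram.notMem_bot]
  · simp [endDiagram, box, ← YoungDiagram.mem_cells]

lemma lt_endPart {b : Bool} {i j : ℕ} : i < endPart b j ↔ b ∧ i = 0 ∧ j = 0 := by
  cases b
  · simp [endPart]
  · simp only [endPart, if_true, Finsupp.single_apply]
    grind

/-- The number of cells of the column over `(j, k)`, as encoded by `x`. -/
def height (μ : YoungDiagram) (x : ℤ → ℕ →₀ ℕ) (j k : ℕ) : ℕ :=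
  x ((j : ℤ) - k) (j - diagRow μ ((j : ℤ) - k))

/-- The 3D partition encoded by `x`. -/
def toSet (μ : YoungDiagram) (x : ℤ → ℕ →₀ ℕ) : Set (ℕ × ℕ × ℕ) :=
  {c | (c.2.1, c.2.2) ∈ μ ∨ c.1 < height μ x c.2.1 c.2.2}

lemma mem_toSet {μ : YoungDiagram} {x : ℤ → ℕ →₀ ℕ} {i j k : ℕ} :
    (i, j, k) ∈ toSet μ x ↔ (j, k) ∈ μ ∨ i < height μ x j k := Iff.rfl

lemma diag_sub (μ : YoungDiagram) (t : ℤ) (i : ℕ) :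
    ((diagRow μ t + i : ℕ) : ℤ) - ((diagRow μ t - t).toNat + i : ℕ) = t := by
  have := le_diagRow μ t
  push_cast
  omega

lemma diag_notMem (μ : YoungDiagram) (t : ℤ) (i : ℕ) :
    (diagRow μ t + i, (diagRow μ t - t).toNat + i) ∉ μ := by
  rw [notMem_iff_diagRow_le, diag_sub]
  omega

lemma height_diag (μ : YoungDiagram) (x : ℤ → ℕ →₀ ℕ) (t : ℤ) (i : ℕ) :
    height μ x (diagRow μ t + i) ((diagRow μ t - t).toNat + i) = x t i := by
  rw [height, diag_sub, Nat.add_sub_cancel_left]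

lemma diag_of_notMem {μ : YoungDiagram} {j k : ℕ} (h : (j, k) ∉ μ) :
    ∃ t i, t = (j : ℤ) - k ∧ j = diagRow μ t + i ∧ k = (diagRow μ t - t).toNat + i := by
  rw [notMem_iff_diagRow_le] at h
  refine ⟨_, j - diagRow μ ((j : ℤ) - k), rfl, by omega, ?_⟩
  have := le_diagRow μ ((j : ℤ) - k)
  omega

lemma toSet_injective (μ : YoungDiagram) : Function.Injective (toSet μ) := by
  intro x y h
  funext t
  ext i
  refine eq_of_forall_lt_iff fun c => ?_
  have := Set.ext_iff.1 h (c, diagRow μ t + i, (diagRow μ t - t).toNat + i)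
  simpa only [mem_toSet, height_diag, diag_notMem, false_or] using this

lemma height_succ_left {μ : YoungDiagram} {x : ℤ → ℕ →₀ ℕ}
    (hx : ∀ t, Step (downSteps μ) t (x t) (x (t + 1))) {j k : ℕ} (h : (j, k) ∉ μ) :
    height μ x (j + 1) k ≤ height μ x j k := by
  rw [notMem_iff_diagRow_le] at h
  unfold height
  have hs := hx ((j : ℤ) - k)
  rw [show ((j + 1 : ℕ) : ℤ) - k = (j : ℤ) - k + 1 by push_cast; ring]
  by_cases ht : (j : ℤ) - k ∈ downSteps μ
  · rw [Step, if_pos ht] at hs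
    rw [diagRow_add_one_of_mem ht, Nat.add_sub_add_right]
    exact (hs _).1
  · rw [Step, if_neg ht] at hs
    rw [diagRow_add_one_of_notMem ht, Nat.sub_add_comm h]
    exact (hs _).2

lemma height_succ_right {μ : YoungDiagram} {x : ℤ → ℕ →₀ ℕ}
    (hx : ∀ t, Step (downSteps μ) t (x t) (x (t + 1))) {j k : ℕ} (h : (j, k) ∉ μ) :
    height μ x j (k + 1) ≤ height μ x j k := by
  rw [notMem_iff_diagRow_le] at h
  unfold height
  have hs := hx ((j : ℤ) - (k + 1 : ℕ))
  have ht' : (j : ℤ) - k = (j : ℤ) - (k + 1 : ℕ) + 1 := by push_cast; ring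
  rw [ht'] at h ⊢
  by_cases ht : (j : ℤ) - (k + 1 : ℕ) ∈ downSteps μ
  · rw [Step, if_pos ht] at hs
    rw [diagRow_add_one_of_mem ht] at h ⊢
    convert (hs _).2 using 2
    omega
  · rw [Step, if_neg ht] at hs
    rw [diagRow_add_one_of_notMem ht]
    exact (hs _).1

lemma height_right {μ : YoungDiagram} {N : ℕ} (hN : bound μ ≤ N) {a b : Bool} {n : ℤ}
    {x : ℤ → ℕ →₀ ℕ} (hx : x ∈ vchains μ N a b n) {j k : ℕ} (h : k + N ≤ j) :
    height μ x j k = endPart b k := by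
  have := diagRow_of_bound_le (μ := μ) (t := (j : ℤ) - k) (by omega)
  rw [height, hx.2.1 _ (by omega)]
  congr 1
  omega

lemma height_left {μ : YoungDiagram} {N : ℕ} (hN : bound μ ≤ N) {a b : Bool} {n : ℤ}
    {x : ℤ → ℕ →₀ ℕ} (hx : x ∈ vchains μ N a b n) {j k : ℕ} (h : j + N ≤ k) :
    height μ x j k = endPart a j := by
  have := diagRow_of_le_neg_bound (μ := μ) (t := (j : ℤ) - k) (by omega)
  rw [height, hx.1 _ (by omega), this, Nat.sub_zero]

lemma isAsymptotic_toSet {μ : YoungDiagram} {N : ℕ} (hN : bound μ ≤ N) {a b : Bool} {n : ℤ}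
    {x : ℤ → ℕ →₀ ℕ} (hx : x ∈ vchains μ N a b n) :
    IsAsymptotic (toSet μ x) μ (endDiagram b) (endDiagram a) := by
  have hs := above_of_mem_chains hx hN
  refine ⟨?_, ?_, ?_, ?_⟩
  · intro i j k h
    by_cases hμ : (j, k) ∈ μ
    · exact Or.inl hμ
    · simp only [mem_toSet] at h ⊢
      have h1 := height_succ_left hs hμ
      have h2 := height_succ_right hs hμ
      have h3 : (j + 1, k) ∉ μ := fun h' => hμ (μ.up_left_mem (Nat.le_succ j) le_rfl h')
      have h4 : (j, k + 1) ∉ μ := fun h' => hμ (μ.up_left_mem le_rfl (Nat.le_succ k) h')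
      simp only [hμ, h3, h4, false_or] at h ⊢
      omega
  · intro j k
    refine ⟨height μ x j k, fun i hi => ?_⟩
    rw [mem_toSet]
    simp [hi.not_gt]
  · intro k i
    refine ⟨k + N, fun j hj => ?_⟩
    have : (j, k) ∉ μ := fun h => by have := (lt_bound_of_mem h).1; omega
    rw [mem_toSet, height_right hN hx hj, mem_endDiagram, lt_endPart]
    simp only [this, false_or]
    tauto
  · intro i j
    refine ⟨j + N, fun k hk => ?_⟩
    have : (j, k) ∉ μ := fun h => by have := (lt_bound_of_mem h).2; omega
    rw [mem_toSet, height_left hN hx hk, mem_endDiagram, lt_endPart]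
    simp only [this, false_or]

lemma IsAsymptotic.mem_of_le {π : Set (ℕ × ℕ × ℕ)} {l m n : YoungDiagram}
    (h : IsAsymptotic π l m n) {i j k i' j' k' : ℕ} (hi : i' ≤ i) (hj : j' ≤ j) (hk : k' ≤ k)
    (hc : (i, j, k) ∈ π) : (i', j', k') ∈ π := by
  have h1 : (i', j, k) ∈ π := by
    induction i, hi using Nat.le_induction with
    | base => exact hc
    | succ i _ ih => exact ih (h.1 _ _ _ (Or.inl hc))
  have h2 : (i', j', k) ∈ π := by
    clear hc
    induction j, hj using Nat.le_induction with
    | base => exact h1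
    | succ j _ ih => exact ih (h.1 _ _ _ (Or.inr (Or.inl h1)))
  clear h1 hc
  induction k, hk using Nat.le_induction with
  | base => exact h2
  | succ k _ ih => exact ih (h.1 _ _ _ (Or.inr (Or.inr h2)))

lemma IsAsymptotic.mem_of_mem_left {π : Set (ℕ × ℕ × ℕ)} {l m n : YoungDiagram}
    (h : IsAsymptotic π l m n) {i j k : ℕ} (hc : (j, k) ∈ l) : (i, j, k) ∈ π := by
  obtain ⟨N, hN⟩ := h.2.1 j k
  exact h.mem_of_le (le_max_right N i) le_rfl le_rfl ((hN _ (le_max_left N i)).2 hc)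

lemma IsAsymptotic.exists_forall_right {π : Set (ℕ × ℕ × ℕ)} {l n : YoungDiagram} {b : Bool}
    (h : IsAsymptotic π l (endDiagram b) n) :
    ∃ N, ∀ j ≥ N, ∀ i k, (i, j, k) ∈ π ↔ i < endPart b k := by
  obtain ⟨N₁, h1⟩ := h.2.2.1 0 0
  obtain ⟨N₂, h2⟩ := h.2.2.1 0 1
  obtain ⟨N₃, h3⟩ := h.2.2.1 1 0
  refine ⟨N₁ + N₂ + N₃, fun j hj i k => ?_⟩
  have h1 := h1 j (by omega)
  have h2 := h2 j (by omega)
  have h3 := h3 j (by omega)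
  rw [mem_endDiagram] at h1 h2 h3
  rw [lt_endPart]
  rcases Nat.eq_zero_or_pos i with rfl | hi
  · rcases Nat.eq_zero_or_pos k with rfl | hk
    · exact h1
    · have : (0, j, k) ∉ π := fun hc => by simpa using h3.1 (h.mem_of_le le_rfl le_rfl hk hc)
      simp [this, hk.ne']
  · have : (i, j, k) ∉ π := fun hc => by
      simpa using h2.1 (h.mem_of_le hi le_rfl (Nat.zero_le k) hc)
    simp [this, hi.ne']

lemma IsAsymptotic.exists_forall_left {π : Set (ℕ × ℕ × ℕ)} {l m : YoungDiagram} {a : Bool}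
    (h : IsAsymptotic π l m (endDiagram a)) :
    ∃ N, ∀ k ≥ N, ∀ i j, (i, j, k) ∈ π ↔ i < endPart a j := by
  obtain ⟨N₁, h1⟩ := h.2.2.2 0 0
  obtain ⟨N₂, h2⟩ := h.2.2.2 0 1
  obtain ⟨N₃, h3⟩ := h.2.2.2 1 0
  refine ⟨N₁ + N₂ + N₃, fun k hk i j => ?_⟩
  have h1 := h1 k (by omega)
  have h2 := h2 k (by omega)
  have h3 := h3 k (by omega)
  rw [mem_endDiagram] at h1 h2 h3
  rw [lt_endPart]
  rcases Nat.eq_zero_or_pos i with rfl | hi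
  · rcases Nat.eq_zero_or_pos j with rfl | hj
    · exact h1
    · have : (0, j, k) ∉ π := fun hc => by simpa using h2.1 (h.mem_of_le le_rfl hj le_rfl hc)
      simp [this, hj.ne']
  · have : (i, j, k) ∉ π := fun hc => by
      simpa using h3.1 (h.mem_of_le hi (Nat.zero_le j) le_rfl hc)
    simp [this, hi.ne']

lemma exists_mem_vchains {μ : YoungDiagram} {a b : Bool} {π : Set (ℕ × ℕ × ℕ)}
    (h : IsAsymptotic π μ (endDiagram b) (endDiagram a)) :
    ∃ N n x, bound μ ≤ N ∧ x ∈ vchains μ N a b n ∧ toSet μ x = π := by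
  obtain ⟨N₁, h1⟩ := h.exists_forall_right
  obtain ⟨N₂, h2⟩ := h.exists_forall_left
  have hex : ∀ j k, ∃ d, (j, k) ∉ μ → ∀ i, (i, j, k) ∈ π ↔ i < d := by
    intro j k
    obtain ⟨N, hN⟩ := h.2.1 j k
    by_cases hμ : (j, k) ∈ μ
    · exact ⟨0, fun h => absurd hμ h⟩
    have hP : ∃ i, (i, j, k) ∉ π := ⟨N, fun hc => hμ ((hN N le_rfl).1 hc)⟩
    refine ⟨Nat.find hP, fun _ i => ?_⟩
    rw [Nat.lt_find_iff]
    exact ⟨fun hc m hm => not_not.2 (h.mem_of_le hm le_rfl le_rfl hc),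
      fun hc => not_not.1 (hc i le_rfl)⟩
  choose d hd using hex
  have hfin : ∀ t : ℤ, (Function.support fun i =>
      d (diagRow μ t + i) ((diagRow μ t - t).toNat + i)).Finite := by
    intro t
    refine (Set.finite_lt_nat (N₁ + 1)).subset fun i hi => ?_
    by_contra hlt
    have hi' := (hd _ _ (diag_notMem μ t i) 0).2 (Nat.pos_of_ne_zero hi)
    rw [Set.mem_ofPred_eq, not_lt] at hlt
    rw [h1 _ (by omega), lt_endPart] at hi'
    omega
  set x : ℤ → ℕ →₀ ℕ := fun t => Finsupp.ofSupportFinite _ (hfin t) with hx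
  have hxt : ∀ t i, x t i = d (diagRow μ t + i) ((diagRow μ t - t).toNat + i) := fun t i => rfl
  have hlt : ∀ t i c, c < x t i ↔ (c, diagRow μ t + i, (diagRow μ t - t).toNat + i) ∈ π :=
    fun t i c => (hd _ _ (diag_notMem μ t i) c).symm
  have hstep : ∀ t, Step (downSteps μ) t (x t) (x (t + 1)) := by
    intro t
    have ht := le_diagRow μ t
    have ht' := le_diagRow μ (t + 1)
    unfold Step
    split_ifs with hS
    · have e := diagRow_add_one_of_mem hS
      intro i
      constructor
      · refine le_of_forall_lt fun c hc => ?_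
        rw [hlt] at hc ⊢
        exact h.mem_of_le le_rfl (by omega) (by omega) hc
      · refine le_of_forall_lt fun c hc => ?_
        rw [hlt] at hc ⊢
        exact h.mem_of_le le_rfl (by omega) (by omega) hc
    · have e := diagRow_add_one_of_notMem hS
      intro i
      constructor
      · refine le_of_forall_lt fun c hc => ?_
        rw [hlt] at hc ⊢
        exact h.mem_of_le le_rfl (by omega) (by omega) hc
      · refine le_of_forall_lt fun c hc => ?_
        rw [hlt] at hc ⊢
        exact h.mem_of_le le_rfl (by omega) (by omega) hc
  set N := N₁ + N₂ + bound μ with hN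
  refine ⟨N, weight (-N) N x - (a.toNat + b.toNat) * (N + 1), x, by omega,
    ⟨fun s hs => ?_, fun s hs => ?_, fun s _ _ => hstep s, by ring⟩, ?_⟩
  · ext i
    have := diagRow_of_le_neg_bound (μ := μ) (t := s) (by omega)
    refine eq_of_forall_lt_iff fun c => ?_
    rw [hlt, h2 _ (by omega), this, zero_add]
  · ext i
    have := diagRow_of_bound_le (μ := μ) (t := s) (by omega)
    refine eq_of_forall_lt_iff fun c => ?_
    rw [hlt, h1 _ (by omega), this, sub_self, Int.toNat_zero, zero_add]
  · ext ⟨i, j, k⟩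
    rw [mem_toSet]
    by_cases hμ : (j, k) ∈ μ
    · simp [hμ, h.mem_of_mem_left hμ]
    · obtain ⟨t, r, -, rfl, rfl⟩ := diag_of_notMem hμ
      rw [height_diag, hlt]
      simp [hμ]

lemma height_of_lt_left {μ : YoungDiagram} {N : ℕ} (hN : bound μ ≤ N) {a b : Bool} {n : ℤ}
    {x : ℤ → ℕ →₀ ℕ} (hx : x ∈ vchains μ N a b n) {j k : ℕ} (h : N < j) :
    height μ x j k = endPart b k := by
  rcases Nat.eq_zero_or_pos k with rfl | hk
  · exact height_right hN hx (by omega)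
  have h0 : ∀ c, endPart b (c + 1) = 0 := fun c => by
    have := (lt_endPart (b := b) (i := 0) (j := c + 1)).not.2 (by simp)
    omega
  have h1 : height μ x j k ≤ height μ x j 1 := by
    induction k, hk using Nat.le_induction with
    | base => exact le_rfl
    | succ k hk ih =>
      refine (height_succ_right (above_of_mem_chains hx hN) fun h' => ?_).trans ih
      have := (lt_bound_of_mem h').1
      omega
  rw [height_right hN hx (show 1 + N ≤ j by omega), h0 0] at h1
  obtain ⟨c, rfl⟩ := Nat.exists_eq_succ_of_ne_zero hk.ne'
  rw [Nat.succ_eq_add_one] at *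
  rw [h0]
  omega

lemma height_of_lt_right {μ : YoungDiagram} {N : ℕ} (hN : bound μ ≤ N) {a b : Bool} {n : ℤ}
    {x : ℤ → ℕ →₀ ℕ} (hx : x ∈ vchains μ N a b n) {j k : ℕ} (h : N < k) :
    height μ x j k = endPart a j := by
  rcases Nat.eq_zero_or_pos j with rfl | hj
  · exact height_left hN hx (by omega)
  have h0 : ∀ c, endPart a (c + 1) = 0 := fun c => by
    have := (lt_endPart (b := a) (i := 0) (j := c + 1)).not.2 (by simp)
    omega
  have h1 : height μ x j k ≤ height μ x 1 k := by
    induction j, hj using Nat.le_induction with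
    | base => exact le_rfl
    | succ j hj ih =>
      refine (height_succ_left (above_of_mem_chains hx hN) fun h' => ?_).trans ih
      have := (lt_bound_of_mem h').2
      omega
  rw [height_left hN hx (show 1 + N ≤ k by omega), h0 0] at h1
  obtain ⟨c, rfl⟩ := Nat.exists_eq_succ_of_ne_zero hj.ne'
  rw [Nat.succ_eq_add_one] at *
  rw [h0]
  omega

lemma diag_le {μ : YoungDiagram} {N : ℕ} (hN : bound μ ≤ N) {a b : Bool} {n : ℤ}
    {x : ℤ → ℕ →₀ ℕ} (hx : x ∈ vchains μ N a b n) {t : ℤ} (ht : -N ≤ t) (ht' : t ≤ N) {i : ℕ}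
    (h : x t i ≠ 0) : diagRow μ t + i ≤ N ∧ (diagRow μ t - t).toNat + i ≤ N := by
  have hd := le_diagRow μ t
  rw [← height_diag μ x t i] at h
  constructor
  · by_contra hlt
    rw [height_of_lt_left hN hx (by omega)] at h
    have := lt_endPart.1 (Nat.pos_of_ne_zero h)
    omega
  · by_contra hlt
    rw [height_of_lt_right hN hx (by omega)] at h
    have := lt_endPart.1 (Nat.pos_of_ne_zero h)
    omega

lemma sum_height {μ : YoungDiagram} {N : ℕ} (hN : bound μ ≤ N) {a b : Bool} {n : ℤ}
    {x : ℤ → ℕ →₀ ℕ} (hx : x ∈ vchains μ N a b n) :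
    ∑ c ∈ Finset.range (N + 1) ×ˢ Finset.range (N + 1),
      (if c ∈ μ then 0 else (height μ x c.1 c.2 : ℤ)) = weight (-N) N x := by
  have h1 : weight (-N) N x =
      ∑ q ∈ Finset.Icc (-N : ℤ) N ×ˢ Finset.range (N + 1), (x q.1 q.2 : ℤ) := by
    rw [Finset.sum_product, weight]
    refine Finset.sum_congr rfl fun t ht => ?_
    rw [Finset.mem_Icc] at ht
    rw [Finsupp.degree_apply, Nat.cast_sum]
    refine Finset.sum_subset (fun i hi => ?_) fun i _ hi => ?_
    · have := diag_le hN hx ht.1 ht.2 (Finsupp.mem_support_iff.1 hi)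
      rw [Finset.mem_range]
      omega
    · simpa using hi
  rw [h1]
  symm
  refine Finset.sum_bij_ne_zero
    (fun q _ _ => (diagRow μ q.1 + q.2, (diagRow μ q.1 - q.1).toNat + q.2)) ?_ ?_ ?_ ?_
  · rintro ⟨t, i⟩ hq hne
    rw [Finset.mem_product, Finset.mem_Icc] at hq
    have := diag_le hN hx (t := t) hq.1.1 hq.1.2 (i := i) (by simpa using hne)
    simp only [Finset.mem_product, Finset.mem_range]
    omega
  · rintro ⟨t, i⟩ - - ⟨t', i'⟩ - - h
    rw [Prod.mk.injEq] at h
    have e : t = t' := by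
      rw [← diag_sub μ t i, ← diag_sub μ t' i', h.1, h.2]
    subst e
    simpa using h.1
  · rintro ⟨j, k⟩ hc hne
    have hμ : (j, k) ∉ μ := fun h => hne (if_pos h)
    rw [if_neg hμ] at hne
    obtain ⟨t, i, ht, rfl, rfl⟩ := diag_of_notMem hμ
    rw [height_diag] at hne
    simp only [Finset.mem_product, Finset.mem_range] at hc
    refine ⟨(t, i), ?_, hne, rfl⟩
    simp only [Finset.mem_product, Finset.mem_range, Finset.mem_Icc]
    omega
  · rintro ⟨t, i⟩ - -
    rw [if_neg (diag_notMem μ t i), height_diag]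

lemma rvol_toSet {μ : YoungDiagram} {N : ℕ} (hN : bound μ ≤ N) {a b : Bool} {n : ℤ}
    {x : ℤ → ℕ →₀ ℕ} (hx : x ∈ vchains μ N a b n) :
    rvol μ (endDiagram b) (endDiagram a) (toSet μ x) = n := by
  set T := Finset.range (N + 1) with hT
  set R := ∑ c ∈ T ×ˢ T, height μ x c.1 c.2 + 1 with hR
  have hbound : ∀ j ≤ N, ∀ k ≤ N, height μ x j k < R := fun j hj k hk =>
    Nat.lt_succ_of_le (Finset.single_le_sum (f := fun c : ℕ × ℕ => height μ x c.1 c.2)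
      (fun _ _ => Nat.zero_le _) (a := (j, k)) (by
        simp only [hT, Finset.mem_product, Finset.mem_range]
        omega))
  have h1 : rvol μ (endDiagram b) (endDiagram a) (toSet μ x) =
      ∑ c ∈ Finset.range R ×ˢ (T ×ˢ T), (toSet μ x).indicator
        (fun c => 1 - legCount μ (endDiagram b) (endDiagram a) c) c := by
    rw [rvol, finsum_mem_def]
    refine finsum_eq_sum_of_support_subset _ ?_
    rintro ⟨i, j, k⟩ hc
    rw [Function.mem_support, Set.indicator_apply_ne_zero] at hc
    obtain ⟨hc, hl⟩ := hc
    rw [Function.mem_support, legCount] at hl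
    simp only [mem_endDiagram] at hl
    simp only [hT, Finset.coe_product, Set.mem_prod, Finset.mem_coe, Finset.mem_range]
    by_cases hμ : (j, k) ∈ μ
    · have := lt_bound_of_mem hμ
      refine ⟨?_, by omega, by omega⟩
      by_contra hi
      have : i ≠ 0 := by omega
      simp [hμ, this] at hl
    · have hc : i < height μ x j k := hc.resolve_left hμ
      have hj : j ≤ N := by
        by_contra hj
        rw [height_of_lt_left hN hx (by omega), lt_endPart] at hc
        obtain ⟨rfl, rfl, rfl⟩ := hc
        have : j ≠ 0 := by omega
        simp [hμ, this] at hl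
      have hk : k ≤ N := by
        by_contra hk
        rw [height_of_lt_right hN hx (by omega), lt_endPart] at hc
        obtain ⟨rfl, rfl, rfl⟩ := hc
        have : k ≠ 0 := by omega
        simp [hμ, this] at hl
      have := hbound j hj k hk
      omega
  have h2 : ∀ c ∈ Finset.range R ×ˢ (T ×ˢ T), (toSet μ x).indicator
        (fun c => 1 - legCount μ (endDiagram b) (endDiagram a) c) c =
      (if c.2 ∈ μ then 0 else if c.1 < height μ x c.2.1 c.2.2 then 1 else 0) -
        (if c.1 = 0 ∧ c.2.2 = 0 ∧ b then 1 else 0) -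
        (if c.1 = 0 ∧ c.2.1 = 0 ∧ a then 1 else 0) := by
    rintro ⟨i, j, k⟩ -
    have hA := isAsymptotic_toSet hN hx
    have hm : ∀ h : k = 0 ∧ i = 0, b → (i, j, k) ∈ toSet μ x := by
      rintro ⟨rfl, rfl⟩ rfl
      obtain ⟨N', hN'⟩ := hA.2.2.1 0 0
      exact hA.mem_of_le le_rfl (le_max_left j N') le_rfl
        ((hN' _ (le_max_right j N')).2 (mem_endDiagram.2 ⟨rfl, rfl, rfl⟩))
    have hn : ∀ h : i = 0 ∧ j = 0, a → (i, j, k) ∈ toSet μ x := by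
      rintro ⟨rfl, rfl⟩ rfl
      obtain ⟨N', hN'⟩ := hA.2.2.2 0 0
      exact hA.mem_of_le le_rfl le_rfl (le_max_left k N')
        ((hN' _ (le_max_right k N')).2 (mem_endDiagram.2 ⟨rfl, rfl, rfl⟩))
    rw [Set.indicator_apply, legCount]
    simp only [mem_endDiagram]
    rw [mem_toSet] at *
    grind
  rw [h1, Finset.sum_congr rfl h2, Finset.sum_sub_distrib, Finset.sum_sub_distrib]
  have e1 : ∑ c ∈ Finset.range R ×ˢ (T ×ˢ T), (if c.2 ∈ μ then 0 else
      if c.1 < height μ x c.2.1 c.2.2 then (1 : ℤ) else 0) = weight (-N) N x := by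
    rw [← sum_height hN hx, Finset.sum_product_right]
    refine Finset.sum_congr rfl fun c hc => ?_
    by_cases hμ : c ∈ μ
    · simp [hμ]
    · simp only [hμ, if_false]
      rw [← Finset.sum_filter, Finset.sum_const, nsmul_eq_mul, mul_one]
      have : (Finset.range R).filter (fun i => i < height μ x c.1 c.2) =
          Finset.range (height μ x c.1 c.2) := by
        simp only [Finset.mem_product, Finset.mem_range] at hc
        have := hbound c.1 (by omega) c.2 (by omega)
        ext i
        simp only [Finset.mem_filter, Finset.mem_range]
        omega
      rw [this, Finset.card_range]
  have e2 : ∑ c ∈ Finset.range R ×ˢ (T ×ˢ T), (if c.1 = 0 ∧ c.2.2 = 0 ∧ b then (1 : ℤ) else 0) =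
      b.toNat * (N + 1) := by
    simp only [Finset.sum_product, ite_and]
    cases b <;> simp [hR, hT]
  have e3 : ∑ c ∈ Finset.range R ×ˢ (T ×ˢ T), (if c.1 = 0 ∧ c.2.1 = 0 ∧ a then (1 : ℤ) else 0) =
      a.toNat * (N + 1) := by
    simp only [Finset.sum_product, ite_and]
    cases a <;> simp [hR, hT]
  rw [e1, e2, e3, hx.2.2.2]
  ring

lemma window_mono (μ : YoungDiagram) : Monotone (window μ) := fun n m h => by
  unfold window
  omega

lemma bound_le_window (μ : YoungDiagram) (n : ℤ) : bound μ ≤ window μ n := Nat.le_add_left _ _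

lemma vertexCoeff_eq_ncard {μ : YoungDiagram} {N : ℕ} {n : ℤ} (hN : window μ n ≤ N) (a b : Bool) :
    vertexCoeff μ (endDiagram b) (endDiagram a) n = (vchains μ N a b n).ncard := by
  have hb : bound μ ≤ N := (bound_le_window μ n).trans hN
  rw [vertexCoeff, ← Set.ncard_image_of_injective _ (toSet_injective μ), ← Nat.card_coe_set_eq]
  congr 2
  refine congrArg (fun s : Set (Set (ℕ × ℕ × ℕ)) => ↥s) (Set.ext fun π => ?_)
  constructor
  · rintro ⟨hA, hr⟩
    obtain ⟨N', n', x, hN', hx, rfl⟩ := exists_mem_vchains hA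
    rw [rvol_toSet hN' hx] at hr
    subst hr
    exact ⟨x, vchains_subset hN hN' a b hx, rfl⟩
  · rintro ⟨x, hx, rfl⟩
    exact ⟨isAsymptotic_toSet hb hx, rvol_toSet hb hx⟩

lemma vertexCoeff_eq_zero {μ : YoungDiagram} {n : ℤ} (hn : n < -(2 * bound μ : ℤ)) (a b : Bool) :
    vertexCoeff μ (endDiagram b) (endDiagram a) n = 0 := by
  rw [vertexCoeff_eq_ncard le_rfl, Nat.cast_eq_zero,
    Set.ncard_eq_zero (finite_vchains (bound_le_window μ n) a b n),
    Set.eq_empty_iff_forall_notMem]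
  intro x hx
  have := neg_le_of_mem_vchains (bound_le_window μ n) hx
  omega

lemma vertex_coeff (μ : YoungDiagram) (a b : Bool) (n : ℤ) :
    (vertex μ (endDiagram b) (endDiagram a)).coeff n =
      vertexCoeff μ (endDiagram b) (endDiagram a) n := by
  have h : (Function.support (vertexCoeff μ (endDiagram b) (endDiagram a))).IsPWO := by
    refine (BddBelow.isWF ⟨-(2 * bound μ : ℤ), fun n hn => ?_⟩).isPWO
    by_contra hlt
    exact hn (vertexCoeff_eq_zero (not_le.1 hlt) a b)
  rw [vertex, dif_pos h]

lemma ncard_vchains_true {μ : YoungDiagram} {N : ℕ} (hN : bound μ ≤ N) (b : Bool) (n : ℤ) :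
    (vchains μ N true b n).ncard =
      ∑ j ∈ Finset.range (2 * N), (if -(N : ℤ) + j ∈ downSteps μ then
        (vchains μ N false b (n - (-N + j))).ncard else 0) +
      if b then (vchains μ N false false (n + 1)).ncard else 0 := by
  have hb : bound μ ≠ 0 := by unfold bound; omega
  have h := encard_chains_true (S := downSteps μ) (lo := -N) (L := 2 * N) (by omega) b
    (n + ((true.toNat : ℤ) + b.toNat) * (N + 1))
  rw [show -(N : ℤ) + (2 * N : ℕ) = N by push_cast; ring] at h
  have h1 : ∀ j : ℕ, chains (downSteps μ) (-N) N (endPart false) (endPart b)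
      (n + ((true.toNat : ℤ) + b.toNat) * (N + 1) - 1 - j) =
        vchains μ N false b (n - (-N + j)) := by
    intro j
    rw [vchains]
    congr 1
    simp
    ring
  have h2 : b → chains (downSteps μ) (-N) N (endPart false) (endPart false)
      (n + ((true.toNat : ℤ) + b.toNat) * (N + 1) - 1 - 2 * N) =
        vchains μ N false false (n + 1) := by
    rintro rfl
    rw [vchains]
    congr 1
    simp
    ring
  simp only [h1] at h
  have h3 : ∀ a b n, (vchains μ N a b n).encard = (vchains μ N a b n).ncard :=
    fun a b n => ((finite_vchains hN a b n).cast_ncard_eq).symm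
  change (vchains μ N true b n).encard = _ at h
  rw [← Nat.cast_inj (R := ℕ∞), ← h3, h]
  push_cast
  simp only [h3]
  congr 1
  split_ifs with hb'
  · rw [h2 hb', h3]
  · rfl

lemma vertexCoeff_rec {μ : YoungDiagram} {N : ℕ} {n : ℤ} (hN : window μ (n + bound μ) ≤ N)
    (b : Bool) :
    vertexCoeff μ (endDiagram b) box n =
      ∑ j ∈ Finset.range N, vertexCoeff μ (endDiagram b) ⊥ (n - rowShift μ j) +
      if b then vertexCoeff μ ⊥ ⊥ (n + 1) else 0 := by
  have hb : bound μ ≤ N := (bound_le_window μ _).trans hN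
  have hb0 : bound μ ≠ 0 := by unfold bound; omega
  have hw : ∀ m ≤ n + bound μ, window μ m ≤ N := fun m hm => (window_mono μ hm).trans hN
  have e1 := vertexCoeff_eq_ncard (hw n (by omega)) true b
  have e2 := vertexCoeff_eq_ncard (hw (n + 1) (by omega)) false false
  have e3 : ∀ j, vertexCoeff μ (endDiagram b) ⊥ (n - rowShift μ j) =
      (vchains μ N false b (n - rowShift μ j)).ncard := fun j =>
    vertexCoeff_eq_ncard (hw _ (by have := neg_bound_lt_rowShift μ j; omega)) false b
  change vertexCoeff μ (endDiagram b) box n = _ at e1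
  change vertexCoeff μ ⊥ ⊥ (n + 1) = _ at e2
  rw [e1, e2, ncard_vchains_true hb, Finset.sum_congr rfl fun j _ => e3 j]
  push_cast
  congr 1
  have hlow : ∀ j, -(N : ℤ) < rowShift μ j := fun j => by
    have := neg_bound_lt_rowShift μ j
    omega
  rw [← Finset.sum_filter]
  symm
  refine Finset.sum_bij (fun j _ => (rowShift μ j + N).toNat) ?_ ?_ ?_ ?_
  · intro j hj
    have h := hlow j
    rw [Finset.mem_range] at hj
    rw [Finset.mem_filter, Finset.mem_range]
    refine ⟨?_, j, ?_⟩
    · have : rowShift μ j ≤ j := by unfold rowShift; omega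
      omega
    · omega
  · intro i _ j _ h
    have := hlow i
    have := hlow j
    exact (strictMono_rowShift μ).injective (by omega)
  · intro t ht
    rw [Finset.mem_filter, Finset.mem_range] at ht
    obtain ⟨ht, j, hj⟩ := ht
    refine ⟨j, ?_, by omega⟩
    rw [Finset.mem_range]
    by_contra hlt
    rw [rowShift_eq (by omega)] at hj
    omega
  · intro j _
    have := hlow j
    rw [show -(N : ℤ) + ((rowShift μ j + N).toNat : ℤ) = rowShift μ j by omega]

lemma vertexCoeff_transpose (l m n : YoungDiagram) :
    vertexCoeff l.transpose n.transpose m.transpose = vertexCoeff l m n := by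
  funext v
  unfold vertexCoeff
  let e : ℕ × ℕ × ℕ ≃ ℕ × ℕ × ℕ := (Equiv.refl ℕ).prodCongr (Equiv.prodComm ℕ ℕ)
  congr 1
  refine (Nat.card_congr ((Equiv.Set.congr e).subtypeEquiv fun π => ?_)).symm
  have hmem : ∀ i j k, (i, k, j) ∈ Equiv.Set.congr e π ↔ (i, j, k) ∈ π := fun i j k => by
    simp [e]
  have ht : ∀ (l : YoungDiagram) i j, (i, j) ∈ l.transpose ↔ (j, i) ∈ l := fun l i j =>
    YoungDiagram.mem_transpose
  have hr : rvol l.transpose n.transpose m.transpose (Equiv.Set.congr e π) = rvol l m n π := by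
    unfold rvol
    rw [finsum_mem_def, finsum_mem_def, ← finsum_comp_equiv e]
    refine finsum_congr fun c => ?_
    obtain ⟨i, j, k⟩ := c
    have hc : e (i, j, k) = (i, k, j) := rfl
    rw [hc, Set.indicator_apply, Set.indicator_apply, hmem, legCount, legCount]
    simp only [ht]
    split_ifs <;> ring
  rw [hr]
  refine and_congr_left fun _ => ?_
  unfold IsAsymptotic
  simp only [hmem, ht]
  constructor
  · rintro ⟨h1, h2, h3, h4⟩
    exact ⟨fun i j k h => h1 i k j (by tauto), fun j k => h2 k j, fun k i => h4 i k,
      fun i j => h3 j i⟩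
  · rintro ⟨h1, h2, h3, h4⟩
    exact ⟨fun i j k h => h1 i k j (by tauto), fun j k => h2 k j, fun k i => h4 i k,
      fun i j => h3 j i⟩

lemma vertex_transpose (l m n : YoungDiagram) :
    vertex l.transpose n.transpose m.transpose = vertex l m n := by
  simp only [vertex, vertexCoeff_transpose]

lemma transpose_endDiagram (b : Bool) : (endDiagram b).transpose = endDiagram b := by
  ext ⟨i, j⟩
  rw [YoungDiagram.mem_cells, YoungDiagram.mem_cells, YoungDiagram.mem_transpose]
  simp only [Prod.swap_prod_mk, mem_endDiagram]
  tauto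

lemma coeff_eq_zero_eventually (v : K) (n : ℤ) : ∃ N₀ : ℕ, ∀ N ≥ N₀, v.coeff (n - N) = 0 := by
  refine ⟨(n - v.order).toNat + 1, fun N hN => HahnSeries.coeff_eq_zero_of_lt_order ?_⟩
  omega

lemma Kp_pow (n : ℕ) : Kp ^ n = HahnSeries.single (n : ℤ) 1 := by
  rw [Kp, HahnSeries.single_pow]
  simp

lemma Kp_pow_mul_inv (m n : ℕ) : Kp ^ m * (Kp ^ n)⁻¹ = HahnSeries.single ((m : ℤ) - n) 1 := by
  have h : Kp ^ n ≠ 0 := by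
    rw [Kp_pow]
    exact HahnSeries.single_ne_zero one_ne_zero
  rw [mul_inv_eq_iff_eq_mul₀ h, Kp_pow, Kp_pow, HahnSeries.single_mul_single]
  simp

lemma one_sub_Kp_ne_zero : (1 : K) - Kp ≠ 0 := by
  intro h
  have := congrArg (fun v : K => v.coeff 1) h
  simp [Kp, HahnSeries.coeff_one] at this

lemma coe_X : ((RatFunc.X : RatFunc ℚ) : K) = Kp := RatFunc.coe_X

lemma coe_Gfun_transpose {μ : YoungDiagram} {N : ℕ} (hN : μ.colLen 0 ≤ N) :
    ((Gfun μ.transpose : RatFunc ℚ) : K) =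
      ∑ j ∈ Finset.range N, HahnSeries.single (rowShift μ j) 1 + Kp ^ N * (1 - Kp)⁻¹ := by
  induction N, hN using Nat.le_induction with
  | base =>
    simp only [Gfun, map_add, map_sum, map_mul, map_inv₀, map_pow, map_sub, map_one, coe_X,
      YoungDiagram.rowLen_transpose, YoungDiagram.colLen_transpose, Kp_pow_mul_inv]
    rfl
  | succ N h ih =>
    have h0 : μ.rowLen N = 0 := by
      by_contra hne
      have := YoungDiagram.mem_iff_lt_colLen.1
        (YoungDiagram.mem_iff_lt_rowLen.2 (Nat.pos_of_ne_zero hne))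
      omega
    have h1 := mul_inv_cancel₀ one_sub_Kp_ne_zero
    have h2 : (HahnSeries.single (rowShift μ N) 1 : K) = Kp ^ N := by
      rw [Kp_pow, rowShift, h0, Nat.cast_zero, sub_zero]
    rw [ih, Finset.sum_range_succ, h2]
    linear_combination Kp ^ N * h1

lemma vertex_box_right (μ : YoungDiagram) (b : Bool) :
    vertex μ (endDiagram b) box =
      ((Gfun μ.transpose : RatFunc ℚ) : K) * vertex μ (endDiagram b) ⊥ +
        if b then HahnSeries.single (-1) 1 * vertex μ ⊥ ⊥ else 0 := by
  ext n
  obtain ⟨N₀, h0⟩ := coeff_eq_zero_eventually ((1 - Kp)⁻¹ * vertex μ (endDiagram b) ⊥) n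
  set N := N₀ + window μ (n + bound μ) with hN
  have hb : μ.colLen 0 ≤ N := by
    have h1 := bound_le_window μ (n + bound μ)
    have h2 : μ.colLen 0 ≤ bound μ := by unfold bound; omega
    omega
  have c1 : (vertex μ (endDiagram b) box).coeff n = vertexCoeff μ (endDiagram b) box n :=
    vertex_coeff μ true b n
  have c2 : ∀ m, (vertex μ (endDiagram b) ⊥).coeff m = vertexCoeff μ (endDiagram b) ⊥ m :=
    vertex_coeff μ false b
  have c3 : ∀ m, (vertex μ ⊥ ⊥).coeff m = vertexCoeff μ ⊥ ⊥ m := vertex_coeff μ false false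
  rw [c1, vertexCoeff_rec (N := N) (Nat.le_add_left _ _), coe_Gfun_transpose hb, add_mul, mul_assoc,
    Finset.sum_mul, Kp_pow, HahnSeries.coeff_add, HahnSeries.coeff_add, HahnSeries.coeff_sum,
    HahnSeries.coeff_single_mul, h0 N (Nat.le_add_right _ _), mul_zero, add_zero]
  congr 1
  · refine Finset.sum_congr rfl fun j _ => ?_
    rw [HahnSeries.coeff_single_mul, one_mul, c2]
  · split_ifs
    · rw [HahnSeries.coeff_single_mul, one_mul, c3, sub_neg_eq_add]
    · rfl

lemma one_sub_mul_sum_inv_pow {F : Type*} [Field F] {q : F} (h0 : q ≠ 0) (n : ℕ) :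
    (1 - q) * ∑ k ∈ Finset.range n, (q ^ (k + 1))⁻¹ = (q ^ n)⁻¹ - 1 := by
  induction n with
  | zero => simp
  | succ n ih =>
    rw [Finset.sum_range_succ, mul_add, ih]
    field_simp
    ring

lemma sum_cells_by_columns {F : Type*} [Field F] {q : F} (h0 : q ≠ 0) (h1 : 1 - q ≠ 0)
    (μ : YoungDiagram) :
    ∑ k ∈ Finset.range (μ.rowLen 0), q ^ μ.colLen k * (q ^ (k + 1))⁻¹ +
        (q ^ μ.rowLen 0)⁻¹ * (q - 1)⁻¹ =
      -((1 - q)⁻¹ + (1 - q) * ∑ c ∈ μ.cells, q ^ c.1 * (q ^ (c.2 + 1))⁻¹) := by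
  have hcells : ∑ c ∈ μ.cells, q ^ c.1 * (q ^ (c.2 + 1))⁻¹ =
      ∑ k ∈ Finset.range (μ.rowLen 0), ∑ j ∈ Finset.range (μ.colLen k),
        q ^ j * (q ^ (k + 1))⁻¹ := by
    refine Finset.sum_finset_product_right' (f := fun j k => q ^ j * (q ^ (k + 1))⁻¹) _ _ _ ?_
    rintro ⟨j, k⟩
    rw [YoungDiagram.mem_cells, Finset.mem_range, Finset.mem_range,
      ← YoungDiagram.mem_iff_lt_rowLen, ← YoungDiagram.mem_iff_lt_colLen]
    exact ⟨fun h => ⟨μ.up_left_mem (Nat.zero_le j) le_rfl h, h⟩, And.right⟩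
  have hcol : (1 - q) * ∑ c ∈ μ.cells, q ^ c.1 * (q ^ (c.2 + 1))⁻¹ =
      ∑ k ∈ Finset.range (μ.rowLen 0), (q ^ (k + 1))⁻¹ -
        ∑ k ∈ Finset.range (μ.rowLen 0), q ^ μ.colLen k * (q ^ (k + 1))⁻¹ := by
    rw [hcells, Finset.mul_sum, ← Finset.sum_sub_distrib]
    refine Finset.sum_congr rfl fun k _ => ?_
    rw [← Finset.sum_mul, ← mul_assoc, mul_neg_geom_sum, sub_mul, one_mul]
  have hinv : (q - 1)⁻¹ = -(1 - q)⁻¹ := by rw [← neg_sub, inv_neg]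
  have hsum : ∑ k ∈ Finset.range (μ.rowLen 0), (q ^ (k + 1))⁻¹ =
      ((q ^ μ.rowLen 0)⁻¹ - 1) * (1 - q)⁻¹ := by
    rw [eq_mul_inv_iff_mul_eq₀ h1, mul_comm, one_sub_mul_sum_inv_pow h0]
  rw [hcol, hsum, hinv]
  ring

lemma sum_cells_by_rows {F : Type*} [Field F] {q : F} (h0 : q ≠ 0) (h1 : 1 - q ≠ 0)
    (μ : YoungDiagram) :
    ∑ j ∈ Finset.range (μ.colLen 0), q ^ j * (q ^ μ.rowLen j)⁻¹ + q ^ μ.colLen 0 * (1 - q)⁻¹ =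
      (1 - q)⁻¹ + (1 - q) * ∑ c ∈ μ.cells, q ^ c.1 * (q ^ (c.2 + 1))⁻¹ := by
  have hcells : ∑ c ∈ μ.cells, q ^ c.1 * (q ^ (c.2 + 1))⁻¹ =
      ∑ j ∈ Finset.range (μ.colLen 0), ∑ k ∈ Finset.range (μ.rowLen j),
        q ^ j * (q ^ (k + 1))⁻¹ := by
    refine Finset.sum_finset_product' (f := fun j k => q ^ j * (q ^ (k + 1))⁻¹) _ _ _ ?_
    rintro ⟨j, k⟩
    rw [YoungDiagram.mem_cells, Finset.mem_range, Finset.mem_range,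
      ← YoungDiagram.mem_iff_lt_rowLen, ← YoungDiagram.mem_iff_lt_colLen]
    exact ⟨fun h => ⟨μ.up_left_mem le_rfl (Nat.zero_le k) h, h⟩, And.right⟩
  have hrow : (1 - q) * ∑ c ∈ μ.cells, q ^ c.1 * (q ^ (c.2 + 1))⁻¹ =
      ∑ j ∈ Finset.range (μ.colLen 0), q ^ j * (q ^ μ.rowLen j)⁻¹ -
        ∑ j ∈ Finset.range (μ.colLen 0), q ^ j := by
    rw [hcells, Finset.mul_sum, ← Finset.sum_sub_distrib]
    refine Finset.sum_congr rfl fun j _ => ?_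
    rw [← Finset.mul_sum, mul_left_comm, one_sub_mul_sum_inv_pow h0]
    ring
  have hsum : ∑ j ∈ Finset.range (μ.colLen 0), q ^ j = (1 - q ^ μ.colLen 0) * (1 - q)⁻¹ := by
    rw [eq_mul_inv_iff_mul_eq₀ h1, mul_comm, mul_neg_geom_sum]
  rw [hrow, hsum]
  ring

lemma Hfun_eq (μ : YoungDiagram) : Hfun μ = -Gfun μ.transpose := by
  have h0 : (RatFunc.X : RatFunc ℚ) ≠ 0 := RatFunc.X_ne_zero
  have h1 : (1 : RatFunc ℚ) - RatFunc.X ≠ 0 := fun h => one_sub_Kp_ne_zero (by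
    simpa only [map_sub, map_one, map_zero, coe_X] using
      congrArg (fun r : RatFunc ℚ => (r : LaurentSeries ℚ)) h)
  simp only [Hfun, Gfun, YoungDiagram.rowLen_transpose, YoungDiagram.colLen_transpose]
  rw [sum_cells_by_columns h0 h1, sum_cells_by_rows h0 h1]

/-- For every partition λ,
  p · V_{λ□□}(p) = V_{λ∅∅}(p) · ι(1 − p·G(λ)·H(λ)),
where ι : ℚ(p) → ℚ((p)) is the Laurent-series expansion at p = 0 (the canonical
coercion `RatFunc ℚ → LaurentSeries ℚ`). -/
theorem statement5 (μ : YoungDiagram) :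
    Kp * vertex μ box box =
      vertex μ ⊥ ⊥ * (((1 - RatFunc.X * Gfun μ * Hfun μ : RatFunc ℚ) : LaurentSeries ℚ)) := by
  have h1 : vertex μ box box = ((Gfun μ.transpose : RatFunc ℚ) : K) * vertex μ box ⊥ +
      HahnSeries.single (-1) 1 * vertex μ ⊥ ⊥ := vertex_box_right μ true
  have h2 : vertex μ.transpose ⊥ box =
      ((Gfun μ : RatFunc ℚ) : K) * vertex μ.transpose ⊥ ⊥ := by
    have := vertex_box_right μ.transpose false
    rw [YoungDiagram.transpose_transpose] at this
    exact this.trans (add_zero _)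
  have hbot : (⊥ : YoungDiagram).transpose = ⊥ := transpose_endDiagram false
  have hbox : box.transpose = box := transpose_endDiagram true
  have h3 : vertex μ.transpose ⊥ box = vertex μ box ⊥ := by
    simpa only [hbot, hbox] using vertex_transpose μ box ⊥
  have h4 : vertex μ.transpose ⊥ ⊥ = vertex μ ⊥ ⊥ := by
    simpa only [hbot] using vertex_transpose μ ⊥ ⊥
  have h5 : Kp * HahnSeries.single (-1) 1 = (1 : K) := by
    rw [Kp, HahnSeries.single_mul_single]
    simp
  rw [Hfun_eq, h1, ← h3, h2, h4]
  simp only [map_sub, map_one, map_mul, map_neg, coe_X]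
  linear_combination vertex μ ⊥ ⊥ * h5
end
end
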